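/- Let Ω ⊂ ℝ^d be an open set and let μ be a finite ℝ^{d×d}-valued Radon measure on Ω whose row-wise distributional divergence Div μ is representable by a finite ℝ^d-valued Radon measure on Ω. Then rank( dμ/d|μ|(x) ) ≤ d − 1 for |μ^s|-almost every x ∈ Ω. -/

import Mathlib

open MeasureTheory Metric

/-- The partial derivative `∂_j φ` of a scalar function on `ℝ^d`. -/
noncomputable def pderiv' {d : ℕ} (j : Fin d) (φ : EuclideanSpace ℝ (Fin d) → ℝ) :
    EuclideanSpace ℝ (Fin d) → ℝ :=
  fun x => fderiv ℝ φ x (EuclideanSpace.single j 1)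

namespace DivMeasure

section kernels

/-- Euclidean space of dimension `d`. -/
abbrev Euc (d : ℕ) := EuclideanSpace ℝ (Fin d)

/-- The regularised norm `√(‖x‖² + s²)`. -/
noncomputable def bracket {d : ℕ} (s : ℝ) (x : Euc d) : ℝ := √(‖x‖ ^ 2 + s ^ 2)

/-- The regularised vector Riesz kernel `x / (‖x‖² + s²)^{d/2}`. -/
noncomputable def riesz {d : ℕ} (s : ℝ) (x : Euc d) : Euc d := ((bracket s x) ^ d)⁻¹ • x

/-- The rank-one operator `x ⊗ x`. -/
noncomputable def tensorSq {d : ℕ} (x : Euc d) : Euc d →L[ℝ] Euc d :=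
  (innerSL ℝ x).smulRight x

/-- The derivative of the regularised Riesz kernel. -/
noncomputable def rieszD {d : ℕ} (s : ℝ) (x : Euc d) : Euc d →L[ℝ] Euc d :=
  ((bracket s x) ^ d)⁻¹ • ContinuousLinearMap.id ℝ (Euc d) -
    ((d : ℝ) * ((bracket s x) ^ (d + 2))⁻¹) • tensorSq x

/-- The divergence of a vector field on Euclidean space. -/
noncomputable def diverg {d : ℕ} (θ : Euc d → Euc d) (x : Euc d) : ℝ :=
  ∑ i, fderiv ℝ θ x (EuclideanSpace.single i 1) i

variable {d : ℕ} {s : ℝ}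

lemma bracket_sq (s : ℝ) (x : Euc d) : bracket s x ^ 2 = ‖x‖ ^ 2 + s ^ 2 :=
  Real.sq_sqrt (by positivity)

lemma bracket_pos (hs : 0 < s) (x : Euc d) : 0 < bracket s x :=
  Real.sqrt_pos.2 (by positivity)

lemma norm_le_bracket (s : ℝ) (x : Euc d) : ‖x‖ ≤ bracket s x :=
  Real.le_sqrt_of_sq_le (by nlinarith [sq_nonneg s])

lemma contDiff_bracket (hs : 0 < s) : ContDiff ℝ (⊤ : ℕ∞) (bracket s : Euc d → ℝ) := by
  unfold bracket
  exact ((contDiff_norm_sq ℝ).add contDiff_const).sqrt (fun x => by positivity)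

lemma hasFDerivAt_bracket (hs : 0 < s) (x : Euc d) :
    HasFDerivAt (bracket s) ((bracket s x)⁻¹ • innerSL ℝ x) x := by
  have h1 : HasFDerivAt (fun x : Euc d => ‖x‖ ^ 2 + s ^ 2) (2 • innerSL ℝ x) x := by
    simpa using (hasStrictFDerivAt_norm_sq x).hasFDerivAt.add_const (s ^ 2)
  have h2 := h1.sqrt (by positivity)
  refine HasFDerivAt.congr_fderiv (f := bracket s) h2 ?_
  ext v
  simp [bracket]
  field_simp

lemma abs_bracket_sub_le (s : ℝ) (x y : Euc d) : |bracket s x - bracket s y| ≤ ‖x - y‖ := by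
  by_cases hs : bracket s x + bracket s y = 0
  · have h1 := norm_le_bracket s x
    have h2 := norm_le_bracket s y
    have := norm_nonneg x
    have := norm_nonneg y
    rw [show bracket s x - bracket s y = 0 by linarith]
    simp
  · have hp : 0 < bracket s x + bracket s y :=
      lt_of_le_of_ne (add_nonneg (Real.sqrt_nonneg _) (Real.sqrt_nonneg _)) (Ne.symm hs)
    have h1 : (bracket s x - bracket s y) * (bracket s x + bracket s y)
        = (‖x‖ - ‖y‖) * (‖x‖ + ‖y‖) := by
      linear_combination bracket_sq s x - bracket_sq s y
    have h2 : |bracket s x - bracket s y| * (bracket s x + bracket s y)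
        ≤ ‖x - y‖ * (bracket s x + bracket s y) := by
      rw [← abs_of_pos hp, ← abs_mul, abs_of_pos hp, h1, abs_mul,
        abs_of_nonneg (add_nonneg (norm_nonneg x) (norm_nonneg y))]
      exact mul_le_mul (abs_norm_sub_norm_le x y)
        (add_le_add (norm_le_bracket s x) (norm_le_bracket s y)) (by positivity) (by positivity)
    exact le_of_mul_le_mul_right h2 hp

lemma contDiff_riesz (hs : 0 < s) : ContDiff ℝ (⊤ : ℕ∞) (riesz s : Euc d → Euc d) := by
  unfold riesz
  exact (((contDiff_bracket hs).pow d).inv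
    (fun x => (pow_pos (bracket_pos hs x) d).ne')).smul contDiff_id

lemma hasFDerivAt_riesz (hs : 0 < s) (x : Euc d) :
    HasFDerivAt (riesz s) (rieszD s x) x := by
  have hp := bracket_pos hs x
  have h1 := ((hasDerivAt_inv (pow_pos hp d).ne').comp_hasFDerivAt x
    ((hasFDerivAt_bracket hs x).pow d)).smul (hasFDerivAt_id x)
  refine HasFDerivAt.congr_fderiv (f := riesz s) h1 ?_
  ext v i
  rcases d with _ | n
  · exact i.elim0
  · simp [rieszD, tensorSq]
    field_simp
    ring

lemma fderiv_riesz (hs : 0 < s) : fderiv ℝ (riesz s : Euc d → Euc d) = rieszD s :=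
  funext fun x => (hasFDerivAt_riesz hs x).fderiv

lemma norm_riesz_le (s : ℝ) (hd : 0 < d) (x : Euc d) : ‖riesz s x‖ ≤ (‖x‖ ^ (d - 1))⁻¹ := by
  rcases eq_or_ne x 0 with rfl | hx
  · simp [riesz]
  · have hx' := norm_pos_iff.2 hx
    obtain ⟨n, rfl⟩ : ∃ n, d = n + 1 := ⟨d - 1, by omega⟩
    rw [riesz, norm_smul, norm_inv, norm_pow,
      Real.norm_of_nonneg (show 0 ≤ bracket s x from Real.sqrt_nonneg _)]
    calc (bracket s x ^ (n + 1))⁻¹ * ‖x‖ ≤ (‖x‖ ^ (n + 1))⁻¹ * ‖x‖ := by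
          gcongr; exact norm_le_bracket s x
      _ = _ := by simp; field_simp; ring

lemma norm_tensorSq_le (x : Euc d) : ‖tensorSq x‖ ≤ ‖x‖ ^ 2 := by
  rw [tensorSq, ContinuousLinearMap.norm_smulRight_apply, innerSL_apply_norm, sq]

lemma norm_rieszD_le (hs : 0 < s) (x : Euc d) :
    ‖rieszD s x‖ ≤ (d + 1) * ((bracket s x) ^ d)⁻¹ := by
  have hp := bracket_pos hs x
  have h1 : ‖((bracket s x) ^ d)⁻¹ • ContinuousLinearMap.id ℝ (Euc d)‖
      ≤ ((bracket s x) ^ d)⁻¹ := by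
    rw [norm_smul, norm_inv, norm_pow, Real.norm_of_nonneg hp.le]
    exact mul_le_of_le_one_right (by positivity) ContinuousLinearMap.norm_id_le
  have h2 : ‖((d : ℝ) * ((bracket s x) ^ (d + 2))⁻¹) • tensorSq x‖
      ≤ d * ((bracket s x) ^ d)⁻¹ := by
    rw [norm_smul, norm_mul, norm_inv, norm_pow, Real.norm_of_nonneg hp.le, Real.norm_natCast]
    calc d * (bracket s x ^ (d + 2))⁻¹ * ‖tensorSq x‖
        ≤ d * (bracket s x ^ (d + 2))⁻¹ * bracket s x ^ 2 := by
          gcongr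
          exact (norm_tensorSq_le x).trans
            (pow_le_pow_left₀ (norm_nonneg _) (norm_le_bracket s x) 2)
      _ = d * ((bracket s x) ^ d)⁻¹ := by field_simp; ring
  calc _ ≤ _ := norm_sub_le _ _
    _ ≤ _ := by linarith

lemma abs_inv_pow_sub_le {a b R : ℝ} (hR : 0 < R) (ha : R ≤ a) (hb : R ≤ b) (n : ℕ) :
    |(a ^ n)⁻¹ - (b ^ n)⁻¹| ≤ n * |a - b| * (R ^ (n + 1))⁻¹ := by
  have ha' := hR.trans_le ha
  have hb' := hR.trans_le hb
  induction n with
  | zero => simp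
  | succ n ih =>
    have e : (a ^ (n + 1))⁻¹ - (b ^ (n + 1))⁻¹
        = (a ^ n)⁻¹ * ((b - a) * (a⁻¹ * b⁻¹)) + ((a ^ n)⁻¹ - (b ^ n)⁻¹) * b⁻¹ := by
      field_simp; ring
    rw [e]
    refine (abs_add_le _ _).trans ?_
    rw [abs_mul, abs_mul (b - a), abs_mul _ (b⁻¹),
      abs_mul ((a ^ n)⁻¹ - (b ^ n)⁻¹), abs_of_pos (show 0 < (a ^ n)⁻¹ by positivity),
      abs_of_pos (show 0 < a⁻¹ by positivity), abs_of_pos (show 0 < b⁻¹ by positivity),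
      abs_sub_comm b a]
    calc _ ≤ (R ^ n)⁻¹ * (|a - b| * (R⁻¹ * R⁻¹)) +
          (n * |a - b| * (R ^ (n + 1))⁻¹) * R⁻¹ := by gcongr
      _ = _ := by push_cast; field_simp; ring

lemma norm_tensorSq_sub_le (x y : Euc d) :
    ‖tensorSq x - tensorSq y‖ ≤ (‖x‖ + ‖y‖) * ‖x - y‖ := by
  have e : tensorSq x - tensorSq y
      = (innerSL ℝ (x - y)).smulRight x + (innerSL ℝ y).smulRight (x - y) := by
    ext v i
    simp [tensorSq]
    ring
  rw [e]
  refine (norm_add_le _ _).trans (le_of_eq ?_)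
  rw [ContinuousLinearMap.norm_smulRight_apply, ContinuousLinearMap.norm_smulRight_apply,
    innerSL_apply_norm, innerSL_apply_norm]
  ring

lemma exists_norm_rieszD_sub_le (d : ℕ) : ∃ C : ℝ, 0 < C ∧ ∀ s : ℝ, 0 < s → ∀ x y : Euc d,
    ‖x - y‖ ≤ ‖x‖ / 2 → ‖rieszD s x - rieszD s y‖ ≤ C * ‖x - y‖ * (‖x‖ ^ (d + 1))⁻¹ := by
  refine ⟨d * 2 ^ (d + 1) + d * (d + 2) * 2 ^ (d + 3) + d * 3 * 2 ^ (d + 2) + 1,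
    by positivity, ?_⟩
  intro s hs x y hxy
  rcases eq_or_ne x 0 with rfl | hx
  · have : y = 0 := by simpa using hxy
    simp [this]
  have hN : 0 < ‖x‖ := norm_pos_iff.2 hx
  have hy : ‖x‖ / 2 ≤ ‖y‖ := by
    have := norm_sub_norm_le x y
    linarith
  have hy2 : ‖y‖ ≤ 2 * ‖x‖ := by
    have := norm_sub_norm_le y x
    rw [norm_sub_rev] at this
    linarith
  set N := ‖x‖
  set δ := ‖x - y‖
  set p := bracket s x with hp
  set q := bracket s y with hq
  have hpR : N / 2 ≤ p := by linarith [norm_le_bracket s x]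
  have hqR : N / 2 ≤ q := by linarith [norm_le_bracket s y]
  have hpq : |p - q| ≤ δ := abs_bracket_sub_le s x y
  have hq0 : 0 < q := bracket_pos hs y
  have e : rieszD s x - rieszD s y = ((p ^ d)⁻¹ - (q ^ d)⁻¹) • ContinuousLinearMap.id ℝ (Euc d)
      - (d * ((p ^ (d + 2))⁻¹ - (q ^ (d + 2))⁻¹)) • tensorSq x
      - (d * (q ^ (d + 2))⁻¹) • (tensorSq x - tensorSq y) := by
    simp only [rieszD, ← hp, ← hq]
    module
  have hδ : 0 ≤ δ := norm_nonneg _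
  have b1 : ‖((p ^ d)⁻¹ - (q ^ d)⁻¹) • ContinuousLinearMap.id ℝ (Euc d)‖
      ≤ d * δ * ((N / 2) ^ (d + 1))⁻¹ := by
    rw [norm_smul, Real.norm_eq_abs]
    refine (mul_le_of_le_one_right (abs_nonneg _) ContinuousLinearMap.norm_id_le).trans ?_
    refine (abs_inv_pow_sub_le (by positivity) hpR hqR d).trans ?_
    gcongr
  have b2 : ‖(d * ((p ^ (d + 2))⁻¹ - (q ^ (d + 2))⁻¹)) • tensorSq x‖
      ≤ d * ((d + 2 : ℕ) * δ * ((N / 2) ^ (d + 2 + 1))⁻¹) * N ^ 2 := by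
    rw [norm_smul, norm_mul, Real.norm_natCast, Real.norm_eq_abs]
    gcongr
    · refine (abs_inv_pow_sub_le (by positivity) hpR hqR (d + 2)).trans ?_
      gcongr
    · exact norm_tensorSq_le x
  have b3 : ‖((d : ℝ) * (q ^ (d + 2))⁻¹) • (tensorSq x - tensorSq y)‖
      ≤ d * ((N / 2) ^ (d + 2))⁻¹ * ((N + 2 * N) * δ) := by
    rw [norm_smul, norm_mul, Real.norm_natCast, norm_inv, norm_pow, Real.norm_of_nonneg hq0.le]
    gcongr
    refine (norm_tensorSq_sub_le x y).trans ?_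
    gcongr
  rw [e]
  refine (norm_sub_le _ _).trans ((add_le_add ((norm_sub_le _ _).trans (add_le_add b1 b2)) b3).trans ?_)
  have : d * δ * ((N / 2) ^ (d + 1))⁻¹ + d * ((d + 2 : ℕ) * δ * ((N / 2) ^ (d + 2 + 1))⁻¹) * N ^ 2
      + d * ((N / 2) ^ (d + 2))⁻¹ * ((N + 2 * N) * δ)
      = (d * 2 ^ (d + 1) + d * (d + 2) * 2 ^ (d + 3) + d * 3 * 2 ^ (d + 2)) * δ *
        (N ^ (d + 1))⁻¹ := by
    push_cast
    simp only [div_pow]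
    field_simp
    ring
  rw [this]
  refine mul_le_mul_of_nonneg_right (mul_le_mul_of_nonneg_right ?_ hδ) (by positivity)
  linarith

lemma rieszD_apply_symm (s : ℝ) (x : Euc d) (i j : Fin d) :
    rieszD s x (EuclideanSpace.single i 1) j = rieszD s x (EuclideanSpace.single j 1) i := by
  simp [rieszD, tensorSq, EuclideanSpace.inner_single_right, eq_comm]
  exact Or.inl (mul_comm _ _)

/-- The divergence of the regularised Riesz kernel. -/
noncomputable def poisson (s : ℝ) (x : Euc d) : ℝ := d * s ^ 2 * ((bracket s x) ^ (d + 2))⁻¹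

lemma sum_rieszD_apply (hs : 0 < s) (x : Euc d) :
    ∑ i, rieszD s x (EuclideanSpace.single i 1) i = poisson s x := by
  have hp := bracket_pos hs x
  have h2 : ∑ i, x i * x i = ‖x‖ ^ 2 := by
    rw [EuclideanSpace.norm_sq_eq]
    simp [sq]
  simp only [rieszD, tensorSq, poisson, _root_.sub_apply,
    _root_.smul_apply, ContinuousLinearMap.smulRight_apply, PiLp.sub_apply,
    PiLp.smul_apply, smul_eq_mul, Finset.sum_sub_distrib, ← Finset.mul_sum,
    ContinuousLinearMap.id_apply, innerSL_apply_apply, EuclideanSpace.inner_single_right]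
  simp only [PiLp.single_apply, if_true, one_mul, conj_trivial, Finset.sum_const,
    Finset.card_univ, Fintype.card_fin, nsmul_eq_mul, mul_one, h2]
  have := bracket_sq s x
  have h3 : ‖x‖ ^ 2 = bracket s x ^ 2 - s ^ 2 := by linarith
  rw [h3]
  field_simp
  ring

end kernels

section convolution

variable {d : ℕ} {s : ℝ}

lemma continuous_bracket_inv_pow (hs : 0 < s) (n : ℕ) :
    Continuous (fun x : Euc d => (bracket s x ^ n)⁻¹) :=
  ((contDiff_bracket hs).continuous.pow n).inv₀ fun x => (pow_pos (bracket_pos hs x) n).ne'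

lemma bracket_smul (hs : 0 < s) (u : Euc d) : bracket s (s • u) = s * bracket 1 u := by
  rw [bracket, bracket, norm_smul, Real.norm_of_nonneg hs.le,
    show (s * ‖u‖) ^ 2 + s ^ 2 = s ^ 2 * (‖u‖ ^ 2 + 1 ^ 2) by ring,
    Real.sqrt_mul (sq_nonneg s), Real.sqrt_sq hs.le]

lemma integrable_bracket_one_inv_pow {n : ℕ} (hn : d < n) :
    Integrable (fun x : Euc d => (bracket 1 x ^ n)⁻¹) := by
  have h := integrable_rpow_neg_one_add_norm_sq (E := Euc d) (μ := volume) (r := n)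
    (by simpa using hn)
  refine h.congr (Filter.Eventually.of_forall fun x => ?_)
  have hp : 0 < 1 + ‖x‖ ^ 2 := by positivity
  simp only [bracket, one_pow]
  rw [add_comm (‖x‖ ^ 2), Real.sqrt_eq_rpow,
    ← Real.rpow_natCast (_ ^ (1 / 2 : ℝ)), ← Real.rpow_mul hp.le,
    ← Real.rpow_neg hp.le]
  congr 1
  ring

lemma integrable_bracket_inv_pow (hs : 0 < s) {n : ℕ} (hn : d < n) :
    Integrable (fun x : Euc d => (bracket s x ^ n)⁻¹) := by
  rw [← integrable_comp_smul_iff volume _ hs.ne']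
  simp only [bracket_smul hs, mul_pow, mul_inv]
  exact (integrable_bracket_one_inv_pow hn).const_mul _

lemma integral_bracket_inv_pow (hs : 0 < s) (n : ℕ) :
    ∫ x : Euc d, (bracket s x ^ n)⁻¹ = s ^ d * (s ^ n)⁻¹ * ∫ x : Euc d, (bracket 1 x ^ n)⁻¹ := by
  have h := Measure.integral_comp_smul_of_nonneg (volume : Measure (Euc d))
    (fun x => (bracket s x ^ n)⁻¹) s (hR := hs.le)
  simp only [bracket_smul hs, mul_pow, mul_inv, integral_const_mul, finrank_euclideanSpace,
    Fintype.card_fin, smul_eq_mul] at h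
  rw [mul_assoc, h]
  field_simp

lemma poisson_nonneg (s : ℝ) (x : Euc d) : 0 ≤ poisson s x := by
  have : 0 ≤ bracket s x := Real.sqrt_nonneg _
  unfold poisson
  positivity

lemma continuous_poisson (hs : 0 < s) : Continuous (poisson s : Euc d → ℝ) :=
  (continuous_bracket_inv_pow hs (d + 2)).const_mul _

lemma integrable_poisson (hs : 0 < s) : Integrable (poisson s : Euc d → ℝ) :=
  (integrable_bracket_inv_pow hs (by omega)).const_mul _

lemma integral_poisson (hs : 0 < s) :
    ∫ x : Euc d, poisson s x = ∫ x : Euc d, poisson 1 x := by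
  simp only [poisson, integral_const_mul]
  rw [integral_bracket_inv_pow hs (d + 2)]
  field_simp
  ring

lemma exists_lintegral_tail_le (d : ℕ) : ∃ C : ℝ, 0 < C ∧ ∀ a : ℝ, 0 < a → ∀ x : Euc d,
    ∫⁻ y in {y : Euc d | a ≤ ‖x - y‖}, ENNReal.ofReal ((‖x - y‖ ^ (d + 1))⁻¹)
      ≤ ENNReal.ofReal (C / a) := by
  refine ⟨2 ^ (d + 1) * (∫ x : Euc d, (bracket 1 x ^ (d + 1))⁻¹) + 1, ?_, ?_⟩
  · have : 0 ≤ ∫ x : Euc d, (bracket 1 x ^ (d + 1))⁻¹ :=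
      integral_nonneg fun x => inv_nonneg.2 (pow_nonneg (Real.sqrt_nonneg _) _)
    positivity
  intro a ha x
  have hInt := (integrable_bracket_inv_pow (d := d) ha (n := d + 1) (by omega)).const_mul
    (2 ^ (d + 1))
  calc ∫⁻ y in {y : Euc d | a ≤ ‖x - y‖}, ENNReal.ofReal ((‖x - y‖ ^ (d + 1))⁻¹)
      ≤ ∫⁻ y in {y : Euc d | a ≤ ‖x - y‖},
          ENNReal.ofReal (2 ^ (d + 1) * (bracket a (x - y) ^ (d + 1))⁻¹) := by
        refine setLIntegral_mono' ?_ fun y hy => ENNReal.ofReal_le_ofReal ?_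
        · exact measurableSet_le measurable_const (by fun_prop)
        · have hy' : a ≤ ‖x - y‖ := hy
          have hpos : 0 < ‖x - y‖ := ha.trans_le hy'
          have h1 : bracket a (x - y) ≤ 2 * ‖x - y‖ := by
            refine Real.sqrt_le_iff.2 ⟨by positivity, ?_⟩
            nlinarith
          have h2 := bracket_pos ha (x - y)
          calc (‖x - y‖ ^ (d + 1))⁻¹ = 2 ^ (d + 1) * ((2 * ‖x - y‖) ^ (d + 1))⁻¹ := by
                rw [mul_pow]; field_simp
            _ ≤ _ := by gcongr
    _ ≤ ∫⁻ y : Euc d, ENNReal.ofReal (2 ^ (d + 1) * (bracket a (x - y) ^ (d + 1))⁻¹) :=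
        setLIntegral_le_lintegral _ _
    _ = ∫⁻ y : Euc d, ENNReal.ofReal (2 ^ (d + 1) * (bracket a y ^ (d + 1))⁻¹) :=
        lintegral_sub_left_eq_self (μ := (volume : Measure (Euc d)))
          (fun y => ENNReal.ofReal (2 ^ (d + 1) * (bracket a y ^ (d + 1))⁻¹)) x
    _ = ENNReal.ofReal (∫ y : Euc d, 2 ^ (d + 1) * (bracket a y ^ (d + 1))⁻¹) := by
        rw [ofReal_integral_eq_lintegral_ofReal hInt]
        exact Filter.Eventually.of_forall fun y =>
          mul_nonneg (by positivity) (inv_nonneg.2 (pow_nonneg (Real.sqrt_nonneg _) _))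
    _ ≤ _ := by
        refine ENNReal.ofReal_le_ofReal ?_
        rw [integral_const_mul, integral_bracket_inv_pow ha]
        have : a ^ d * (a ^ (d + 1))⁻¹ = a⁻¹ := by field_simp; ring
        rw [this, div_eq_mul_inv]
        have := inv_pos.2 ha
        nlinarith

lemma lintegral_ball_riesz_ne_top (hd : 0 < d) :
    ∫⁻ z in ball (0 : Euc d) 1, ENNReal.ofReal ((‖z‖ ^ (d - 1))⁻¹) ≠ ⊤ := by
  have : Nontrivial (Euc d) := by
    have : Nonempty (Fin d) := ⟨⟨0, hd⟩⟩
    infer_instance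
  have h : IntegrableOn (fun z : Euc d => (‖z‖ ^ (d - 1))⁻¹) (ball 0 1) := by
    rw [integrableOn_fun_norm_addHaar volume (f := fun t : ℝ => (t ^ (d - 1))⁻¹)]
    rw [integrableOn_congr_fun (g := fun _ => (1 : ℝ)) _ measurableSet_Ioo]
    · exact integrableOn_const (by simp)
    · intro t ht
      have := ht.1
      simp only [finrank_euclideanSpace, Fintype.card_fin, smul_eq_mul]
      field_simp
  exact h.lintegral_lt_top.ne

lemma lintegral_riesz_sub_le (x : Euc d) {S : Set (Euc d)} (hS : MeasurableSet S) :
    ∫⁻ y in S, ENNReal.ofReal ((‖x - y‖ ^ (d - 1))⁻¹) ≤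
      (∫⁻ z in (fun y => x - y) ⁻¹' S, (ball (0 : Euc d) 1).indicator
        (fun z => ENNReal.ofReal ((‖z‖ ^ (d - 1))⁻¹)) z) + volume S := by
  have hS' : MeasurableSet ((fun y => x - y) ⁻¹' S) := (measurable_const.sub measurable_id) hS
  have hmeas : ∀ T : Set (Euc d), MeasurableSet T →
      ∫⁻ y, (T.indicator 1 (x - y) : ENNReal) = volume T := by
    intro T hT
    rw [lintegral_sub_left_eq_self (μ := (volume : Measure (Euc d))) (fun y => T.indicator 1 y) x,
      lintegral_indicator_one hT]
  calc ∫⁻ y in S, ENNReal.ofReal ((‖x - y‖ ^ (d - 1))⁻¹)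
      ≤ ∫⁻ y, (((fun y => x - y) ⁻¹' S).indicator ((ball (0 : Euc d) 1).indicator
        (fun z => ENNReal.ofReal ((‖z‖ ^ (d - 1))⁻¹))) (x - y) + S.indicator 1 y) := by
        rw [← lintegral_indicator hS]
        refine lintegral_mono fun y => ?_
        by_cases hy : y ∈ S
        · have : x - y ∈ (fun y => x - y) ⁻¹' S := by simpa using hy
          simp only [hy, this, Set.indicator_of_mem, Pi.one_apply]
          by_cases hb : x - y ∈ ball (0 : Euc d) 1
          · simp [hb]
          · simp only [hb, not_false_eq_true, Set.indicator_of_notMem, zero_add]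
            rw [ENNReal.ofReal_le_one]
            refine inv_le_one_of_one_le₀ (one_le_pow₀ ?_)
            simpa using hb
        · simp [hy]
    _ = (∫⁻ y, ((fun y => x - y) ⁻¹' S).indicator ((ball (0 : Euc d) 1).indicator
        (fun z => ENNReal.ofReal ((‖z‖ ^ (d - 1))⁻¹))) (x - y)) + volume S := by
        rw [lintegral_add_right _ (measurable_one.indicator hS), lintegral_indicator_one hS]
    _ = _ := by
        rw [lintegral_sub_left_eq_self (μ := (volume : Measure (Euc d))), lintegral_indicator hS']

lemma exists_lintegral_riesz_sub_le (hd : 0 < d) {η : ℝ} (hη : 0 < η) : ∃ κ : ℝ, 0 < κ ∧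
    ∀ (x : Euc d) (S : Set (Euc d)), MeasurableSet S → volume S ≤ ENNReal.ofReal κ →
      ∫⁻ y in S, ENNReal.ofReal ((‖x - y‖ ^ (d - 1))⁻¹) ≤ ENNReal.ofReal η := by
  have hne : ∫⁻ z, (ball (0 : Euc d) 1).indicator
      (fun z => ENNReal.ofReal ((‖z‖ ^ (d - 1))⁻¹)) z ≠ ⊤ := by
    rw [lintegral_indicator measurableSet_ball]
    exact lintegral_ball_riesz_ne_top hd
  obtain ⟨δ, hδ, h⟩ := exists_pos_setLIntegral_lt_of_measure_lt hne
    (ε := ENNReal.ofReal (η / 2)) (by simpa using hη)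
  obtain ⟨κ, hκ, hκδ⟩ : ∃ κ : ℝ, 0 < κ ∧ ENNReal.ofReal κ < δ := by
    obtain ⟨q, hq, hq'⟩ := ENNReal.lt_iff_exists_nnreal_btwn.1 hδ
    exact ⟨q, by simpa using hq, by simpa using hq'⟩
  refine ⟨min κ (η / 2), by positivity, fun x S hS hvol => ?_⟩
  refine (lintegral_riesz_sub_le x hS).trans ?_
  rw [show η = η / 2 + η / 2 by ring, ENNReal.ofReal_add (by positivity) (by positivity)]
  refine add_le_add (h _ ?_).le (hvol.trans (ENNReal.ofReal_le_ofReal (min_le_right _ _)))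
  have hpre : volume ((fun y => x - y) ⁻¹' S) = volume S :=
    (Measure.measurePreserving_sub_left volume x).measure_preimage hS.nullMeasurableSet
  rw [hpre]
  exact (hvol.trans (ENNReal.ofReal_le_ofReal (min_le_left _ _))).trans_lt hκδ

lemma exists_lintegral_riesz_closedBall_le (hd : 0 < d) : ∃ C : ℝ, 0 < C ∧ ∀ x : Euc d,
    ∫⁻ y in closedBall (0 : Euc d) 1, ENNReal.ofReal ((‖x - y‖ ^ (d - 1))⁻¹)
      ≤ ENNReal.ofReal C := by
  have hne : (∫⁻ z, (ball (0 : Euc d) 1).indicator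
      (fun z => ENNReal.ofReal ((‖z‖ ^ (d - 1))⁻¹)) z) + volume (closedBall (0 : Euc d) 1) ≠ ⊤ := by
    rw [lintegral_indicator measurableSet_ball]
    exact ENNReal.add_ne_top.2 ⟨lintegral_ball_riesz_ne_top hd, measure_closedBall_lt_top.ne⟩
  refine ⟨ENNReal.toReal ((∫⁻ z, (ball (0 : Euc d) 1).indicator
      (fun z => ENNReal.ofReal ((‖z‖ ^ (d - 1))⁻¹)) z) + volume (closedBall (0 : Euc d) 1)) + 1,
    by positivity, fun x => (lintegral_riesz_sub_le x measurableSet_closedBall).trans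
    (le_trans ?_ (ENNReal.ofReal_le_ofReal (le_add_of_nonneg_right zero_le_one)))⟩
  rw [ENNReal.ofReal_toReal hne]
  gcongr
  exact Measure.restrict_le_self

end convolution

section oscillation

variable {d : ℕ} {s : ℝ} {F : Type*} [NormedAddCommGroup F] [NormedSpace ℝ F]
  {h : Euc d → ℝ} {K : Euc d → F}

/-- Convolution of a scalar density with a vector-valued kernel. -/
noncomputable def cnv (h : Euc d → ℝ) (K : Euc d → F) (x : Euc d) : F := ∫ y, h y • K (x - y)

lemma cnv_eq_convolution (h : Euc d → ℝ) (K : Euc d → F) :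
    cnv h K = convolution h K (ContinuousLinearMap.lsmul ℝ ℝ) volume := rfl

lemma integrable_cnv (hI : Integrable h) (h0 : ∀ y, y ∉ closedBall (0 : Euc d) 1 → h y = 0)
    (hK : Continuous K) (x : Euc d) : Integrable (fun y => h y • K (x - y)) := by
  obtain ⟨C, hC⟩ := (isCompact_closedBall (0 : Euc d) 1).exists_bound_of_continuousOn
    (f := fun y => K (x - y)) (by fun_prop)
  refine Integrable.mono' (hI.norm.const_mul C) ?_ (Filter.Eventually.of_forall fun y => ?_)
  · exact hI.aestronglyMeasurable.smul (hK.comp (continuous_const.sub continuous_id)).aestronglyMeasurable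
  · by_cases hy : y ∈ closedBall (0 : Euc d) 1
    · rw [norm_smul, mul_comm]
      gcongr
      exact hC y hy
    · simp [h0 y hy]

lemma clm_cnv [CompleteSpace F] {G : Type*} [NormedAddCommGroup G] [NormedSpace ℝ G]
    [CompleteSpace G] (hI : Integrable h) (h0 : ∀ y, y ∉ closedBall (0 : Euc d) 1 → h y = 0)
    (hK : Continuous K) (L : F →L[ℝ] G) (x : Euc d) :
    L (cnv h K x) = cnv h (fun z => L (K z)) x := by
  unfold cnv
  rw [← L.integral_comp_comm (integrable_cnv hI h0 hK x)]
  simp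

lemma cnv_smooth_aux (hI : Integrable h) (h0 : ∀ y, y ∉ closedBall (0 : Euc d) 1 → h y = 0)
    (hK : ContDiff ℝ (⊤ : ℕ∞) K) (x₀ : Euc d) :
    ContDiffAt ℝ (⊤ : ℕ∞) (cnv h K) x₀ ∧ HasFDerivAt (cnv h K) (cnv h (fderiv ℝ K) x₀) x₀ := by
  let ζ : ContDiffBump (0 : Euc d) :=
    ⟨‖x₀‖ + 3, ‖x₀‖ + 4, by positivity, by linarith⟩
  let K' : Euc d → F := fun z => ζ z • K z
  have hK' : ContDiff ℝ (⊤ : ℕ∞) K' := ζ.contDiff.smul hK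
  have hK's : HasCompactSupport K' := ζ.hasCompactSupport.smul_right
  have hloc : ∀ z ∈ ball (0 : Euc d) (‖x₀‖ + 3), K' z = K z := fun z hz => by
    simp only [K', ζ.one_of_mem_closedBall (ball_subset_closedBall hz), one_smul]
  have hmem : ∀ x ∈ ball x₀ 1, ∀ y ∈ closedBall (0 : Euc d) 1,
      x - y ∈ ball (0 : Euc d) (‖x₀‖ + 3) := by
    intro x hx y hy
    rw [mem_ball_zero_iff]
    rw [mem_closedBall_zero_iff] at hy
    rw [mem_ball_iff_norm] at hx
    have h1 := norm_sub_le x y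
    have h2 := norm_le_norm_add_norm_sub' x x₀
    linarith
  have heq : cnv h K =ᶠ[nhds x₀] cnv h K' := by
    filter_upwards [ball_mem_nhds x₀ one_pos] with x hx
    unfold cnv
    refine integral_congr_ae (Filter.Eventually.of_forall fun y => ?_)
    by_cases hy : y ∈ closedBall (0 : Euc d) 1
    · simp only [hloc _ (hmem x hx y hy)]
    · simp [h0 y hy]
  have hderiv : cnv h (fderiv ℝ K) x₀ =
      convolution h (fderiv ℝ K') ((ContinuousLinearMap.lsmul ℝ ℝ).precompR (Euc d)) volume x₀ := by
    unfold cnv convolution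
    refine integral_congr_ae (Filter.Eventually.of_forall fun y => ?_)
    by_cases hy : y ∈ closedBall (0 : Euc d) 1
    · have hev : K' =ᶠ[nhds (x₀ - y)] K := by
        filter_upwards [isOpen_ball.mem_nhds (hmem x₀ (mem_ball_self one_pos) y hy)] with z hz
          using hloc z hz
      simp only [hev.fderiv_eq]
      ext v
      simp
    · ext v
      simp [h0 y hy]
  constructor
  · refine ContDiffAt.congr_of_eventuallyEq ?_ heq
    exact (hK's.contDiff_convolution_right (ContinuousLinearMap.lsmul ℝ ℝ)
      hI.locallyIntegrable hK').contDiffAt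
  · rw [hderiv]
    refine HasFDerivAt.congr_of_eventuallyEq ?_ heq
    exact hK's.hasFDerivAt_convolution_right (ContinuousLinearMap.lsmul ℝ ℝ)
      hI.locallyIntegrable (hK'.of_le (by exact_mod_cast le_top)) x₀

lemma contDiff_cnv (hI : Integrable h) (h0 : ∀ y, y ∉ closedBall (0 : Euc d) 1 → h y = 0)
    (hK : ContDiff ℝ (⊤ : ℕ∞) K) : ContDiff ℝ (⊤ : ℕ∞) (cnv h K) :=
  contDiff_iff_contDiffAt.2 fun x => (cnv_smooth_aux hI h0 hK x).1

lemma hasFDerivAt_cnv (hI : Integrable h) (h0 : ∀ y, y ∉ closedBall (0 : Euc d) 1 → h y = 0)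
    (hK : ContDiff ℝ (⊤ : ℕ∞) K) (x : Euc d) :
    HasFDerivAt (cnv h K) (cnv h (fderiv ℝ K) x) x :=
  (cnv_smooth_aux hI h0 hK x).2

lemma hasFDerivAt_cnv_riesz (hs : 0 < s) (hI : Integrable h)
    (h0 : ∀ y, y ∉ closedBall (0 : Euc d) 1 → h y = 0) (x : Euc d) :
    HasFDerivAt (cnv h (riesz s)) (cnv h (rieszD s) x) x := by
  have := hasFDerivAt_cnv hI h0 (contDiff_riesz hs) x
  rwa [fderiv_riesz hs] at this

lemma contDiff_rieszD (hs : 0 < s) :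
    ContDiff ℝ (⊤ : ℕ∞) (rieszD s : Euc d → Euc d →L[ℝ] Euc d) := by
  rw [← fderiv_riesz hs]
  exact (contDiff_riesz hs).fderiv_right (m := (⊤ : ℕ∞)) (by simp)

lemma enorm_cnv_le {S : Set (Euc d)} (hS : MeasurableSet S) (hb : ∀ y, |h y| ≤ 1)
    (hS0 : ∀ y, y ∉ S → h y = 0) {w : Euc d → ℝ} (hw : ∀ z, ‖K z‖ ≤ w z) (x : Euc d) :
    ‖cnv h K x‖ₑ ≤ ∫⁻ y in S, ENNReal.ofReal (w (x - y)) := by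
  unfold cnv
  refine (enorm_integral_le_lintegral_enorm _).trans ?_
  rw [← lintegral_indicator hS]
  refine lintegral_mono fun y => ?_
  by_cases hy : y ∈ S
  · rw [Set.indicator_of_mem hy, ← ofReal_norm]
    refine ENNReal.ofReal_le_ofReal ?_
    rw [norm_smul, Real.norm_eq_abs]
    exact (mul_le_of_le_one_left (norm_nonneg _) (hb y)).trans (hw _)
  · simp [hS0 y hy]

lemma exists_osc_cnv_rieszD (d : ℕ) : ∃ A : ℝ, 0 < A ∧ ∀ s : ℝ, 0 < s → ∀ (S : Set (Euc d))
    (h : Euc d → ℝ), Integrable h → (∀ y, y ∉ closedBall (0 : Euc d) 1 → h y = 0) →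
    (∀ y, |h y| ≤ 1) → (∀ y, y ∉ S → h y = 0) → ∀ x x' : Euc d,
    dist x x' < infDist x S / 4 → ‖cnv h (rieszD s) x - cnv h (rieszD s) x'‖ ≤ A := by
  obtain ⟨C, hC, hCb⟩ := exists_norm_rieszD_sub_le d
  obtain ⟨C', hC', hCb'⟩ := exists_lintegral_tail_le d
  refine ⟨C * C', by positivity, fun s hs S h hI h0 hb hS0 x x' hxx' => ?_⟩
  set a := infDist x S / 4 with ha_def
  have ha : 0 < a := dist_nonneg.trans_lt hxx'
  have hcont := (contDiff_rieszD (d := d) hs).continuous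
  have e : cnv h (rieszD s) x - cnv h (rieszD s) x' =
      ∫ y, h y • (rieszD s (x - y) - rieszD s (x' - y)) := by
    unfold cnv
    rw [← integral_sub (integrable_cnv hI h0 hcont x) (integrable_cnv hI h0 hcont x')]
    simp [smul_sub]
  rw [e]
  have hmeas : MeasurableSet {y : Euc d | a ≤ ‖x - y‖} :=
    measurableSet_le measurable_const (by fun_prop)
  have key : ‖∫ y, h y • (rieszD s (x - y) - rieszD s (x' - y))‖ₑ ≤ ENNReal.ofReal (C * C') := by
    calc _ ≤ ∫⁻ y, ‖h y • (rieszD s (x - y) - rieszD s (x' - y))‖ₑ :=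
          enorm_integral_le_lintegral_enorm _
      _ ≤ ∫⁻ y in {y : Euc d | a ≤ ‖x - y‖},
          ENNReal.ofReal (C * a) * ENNReal.ofReal ((‖x - y‖ ^ (d + 1))⁻¹) := by
          rw [← lintegral_indicator hmeas]
          refine lintegral_mono fun y => ?_
          by_cases hy : y ∈ S
          · have h4 : 4 * a ≤ ‖x - y‖ := by
              rw [← dist_eq_norm, ha_def]
              linarith [infDist_le_dist_of_mem (x := x) hy]
            have hy' : y ∈ {y : Euc d | a ≤ ‖x - y‖} := by
              change a ≤ ‖x - y‖
              linarith
            have hd : ‖(x - y) - (x' - y)‖ = dist x x' := by rw [dist_eq_norm]; congr 1; abel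
            rw [Set.indicator_of_mem hy', ← ENNReal.ofReal_mul (by positivity), ← ofReal_norm]
            refine ENNReal.ofReal_le_ofReal ?_
            rw [norm_smul, Real.norm_eq_abs]
            refine (mul_le_of_le_one_left (norm_nonneg _) (hb y)).trans ?_
            refine (hCb s hs (x - y) (x' - y) (by rw [hd]; linarith)).trans ?_
            rw [hd]
            gcongr
          · rw [← ofReal_norm, norm_smul, hS0 y hy, norm_zero, zero_mul, ENNReal.ofReal_zero]
            exact zero_le
      _ ≤ ENNReal.ofReal (C * a) * ENNReal.ofReal (C' / a) := by
          rw [lintegral_const_mul' _ _ ENNReal.ofReal_ne_top]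
          gcongr
          exact hCb' a ha x
      _ = _ := by
          rw [← ENNReal.ofReal_mul (by positivity)]
          congr 1
          field_simp
  rw [← ofReal_norm] at key
  exact (ENNReal.ofReal_le_ofReal_iff (by positivity)).1 key

lemma half_norm_le_norm_sub {x y : Euc d} (hx : 4 ≤ ‖x‖) (hy : y ∈ closedBall (0 : Euc d) 1) :
    ‖x‖ / 2 ≤ ‖x - y‖ := by
  rw [mem_closedBall_zero_iff] at hy
  have := norm_sub_norm_le x y
  linarith

lemma norm_cnv_decay (hI : Integrable h) (h0 : ∀ y, y ∉ closedBall (0 : Euc d) 1 → h y = 0)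
    {c : ℝ} (hc : 0 ≤ c) {m : ℕ} (hK : ∀ z, z ≠ 0 → ‖K z‖ ≤ c * (‖z‖ ^ m)⁻¹) {x : Euc d} (hx : 4 ≤ ‖x‖) :
    ‖cnv h K x‖ ≤ (c * 2 ^ m * ∫ y, ‖h y‖) * (‖x‖ ^ m)⁻¹ := by
  unfold cnv
  have hx0 : 0 < ‖x‖ := by linarith
  have : ∫ y, ‖h y‖ * (c * 2 ^ m * (‖x‖ ^ m)⁻¹) = (c * 2 ^ m * ∫ y, ‖h y‖) * (‖x‖ ^ m)⁻¹ := by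
    rw [integral_mul_const]; ring
  rw [← this]
  refine norm_integral_le_of_norm_le (hI.norm.mul_const _) (Filter.Eventually.of_forall fun y => ?_)
  by_cases hy : y ∈ closedBall (0 : Euc d) 1
  · have hxy := half_norm_le_norm_sub hx hy
    rw [norm_smul]
    refine mul_le_mul_of_nonneg_left ((hK _ (norm_pos_iff.1 (by linarith))).trans ?_)
      (norm_nonneg _)
    calc c * (‖x - y‖ ^ m)⁻¹ ≤ c * ((‖x‖ / 2) ^ m)⁻¹ := by
          gcongr
      _ = _ := by rw [div_pow]; field_simp
  · simp [h0 y hy]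

lemma norm_fderiv_cnv_rieszD_decay (hs : 0 < s) (hI : Integrable h)
    (h0 : ∀ y, y ∉ closedBall (0 : Euc d) 1 → h y = 0) : ∃ C : ℝ, ∀ x : Euc d, 4 ≤ ‖x‖ →
      ‖fderiv ℝ (cnv h (rieszD s)) x‖ ≤ C * (‖x‖ ^ (d + 1))⁻¹ := by
  obtain ⟨C, hC, hCb⟩ := exists_norm_rieszD_sub_le d
  have hcont := (contDiff_rieszD (d := d) hs).continuous
  refine ⟨C * 2 ^ (d + 1) * ∫ y, ‖h y‖, fun x hx => ?_⟩
  have hx0 : 0 < ‖x‖ := by linarith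
  have hInt : 0 ≤ ∫ y, ‖h y‖ := integral_nonneg fun _ => norm_nonneg _
  refine (hasFDerivAt_cnv hI h0 (contDiff_rieszD hs) x).differentiableAt.hasFDerivAt.le_of_lip'
    (by positivity) ?_
  filter_upwards [ball_mem_nhds x one_pos] with x' hx'
  have hxx : ‖x - x'‖ < 1 := by rw [← dist_eq_norm, dist_comm]; exact hx'
  rw [norm_sub_rev]
  have e : cnv h (rieszD s) x - cnv h (rieszD s) x' =
      ∫ y, h y • (rieszD s (x - y) - rieszD s (x' - y)) := by
    unfold cnv
    rw [← integral_sub (integrable_cnv hI h0 hcont x) (integrable_cnv hI h0 hcont x')]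
    simp [smul_sub]
  have : ∫ y, ‖h y‖ * (C * ‖x - x'‖ * (2 ^ (d + 1) * (‖x‖ ^ (d + 1))⁻¹)) =
      C * 2 ^ (d + 1) * (∫ y, ‖h y‖) * (‖x‖ ^ (d + 1))⁻¹ * ‖x' - x‖ := by
    rw [integral_mul_const, norm_sub_rev x x']; ring
  rw [e, ← this]
  refine norm_integral_le_of_norm_le (hI.norm.mul_const _) (Filter.Eventually.of_forall fun y => ?_)
  by_cases hy : y ∈ closedBall (0 : Euc d) 1
  · have hxy := half_norm_le_norm_sub hx hy
    have hd : ‖(x - y) - (x' - y)‖ = ‖x - x'‖ := by congr 1; abel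
    rw [norm_smul]
    refine mul_le_mul_of_nonneg_left ?_ (norm_nonneg _)
    refine (hCb s hs (x - y) (x' - y) (by rw [hd]; linarith)).trans ?_
    rw [hd]
    gcongr
    calc (‖x - y‖ ^ (d + 1))⁻¹ ≤ ((‖x‖ / 2) ^ (d + 1))⁻¹ := by gcongr
      _ = _ := by rw [div_pow]; field_simp
  · rw [norm_smul, h0 y hy, norm_zero, zero_mul, zero_mul]

lemma integrable_of_decay {u : Euc d → ℝ} (hu : Continuous u) {m : ℕ} (hm : d < m) {C : ℝ}
    (hC : ∀ x : Euc d, 4 ≤ ‖x‖ → |u x| ≤ C * (‖x‖ ^ m)⁻¹) : Integrable u := by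
  obtain ⟨M, hM⟩ := (isCompact_closedBall (0 : Euc d) 4).exists_bound_of_continuousOn
    hu.continuousOn
  refine Integrable.mono' ((integrable_bracket_one_inv_pow hm).const_mul
    (|M| * 5 ^ m + |C| * 2 ^ m)) hu.aestronglyMeasurable (Filter.Eventually.of_forall fun x => ?_)
  have hb := bracket_pos one_pos x
  rcases le_total 4 ‖x‖ with hx | hx
  · have hx0 : 0 < ‖x‖ := by linarith
    have h1 : bracket 1 x ≤ 2 * ‖x‖ := Real.sqrt_le_iff.2 ⟨by positivity, by nlinarith⟩
    calc ‖u x‖ ≤ |C| * (‖x‖ ^ m)⁻¹ :=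
          (hC x hx).trans (mul_le_mul_of_nonneg_right (le_abs_self C) (by positivity))
      _ = |C| * 2 ^ m * ((2 * ‖x‖) ^ m)⁻¹ := by rw [mul_pow]; field_simp
      _ ≤ |C| * 2 ^ m * (bracket 1 x ^ m)⁻¹ := by gcongr
      _ ≤ _ := by gcongr; exact le_add_of_nonneg_left (by positivity)
  · have h1 : bracket 1 x ≤ 5 := Real.sqrt_le_iff.2 ⟨by positivity, by nlinarith [norm_nonneg x]⟩
    calc ‖u x‖ ≤ |M| * 1 := by
          rw [mul_one]
          exact (hM x (by simpa using hx)).trans (le_abs_self M)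
      _ = |M| * 5 ^ m * (5 ^ m)⁻¹ := by field_simp
      _ ≤ |M| * 5 ^ m * (bracket 1 x ^ m)⁻¹ := by gcongr
      _ ≤ _ := by gcongr; exact le_add_of_nonneg_right (by positivity)

end oscillation

section energy

variable {d : ℕ} {s : ℝ} {h : Euc d → ℝ}

lemma abs_coord_le (x : Euc d) (i : Fin d) : |x i| ≤ ‖x‖ := by
  simpa using PiLp.norm_apply_le x i

lemma abs_apply_single_le (L : Euc d →L[ℝ] Euc d) (i j : Fin d) :
    |L (EuclideanSpace.single i 1) j| ≤ ‖L‖ :=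
  (abs_coord_le _ j).trans (by simpa using L.le_opNorm (EuclideanSpace.single i (1 : ℝ)))

lemma norm_sq_le_sum_sq (L : Euc d →L[ℝ] Euc d) :
    ‖L‖ ^ 2 ≤ ∑ i, ∑ j, (L (EuclideanSpace.single i 1) j) ^ 2 := by
  set S := ∑ i, ∑ j, (L (EuclideanSpace.single i 1) j) ^ 2 with hS
  have hS0 : 0 ≤ S := Finset.sum_nonneg fun i _ => Finset.sum_nonneg fun j _ => sq_nonneg _
  suffices ‖L‖ ≤ √S by
    calc ‖L‖ ^ 2 ≤ √S ^ 2 := by gcongr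
      _ = S := Real.sq_sqrt hS0
  refine L.opNorm_le_bound (Real.sqrt_nonneg _) fun v => ?_
  refine (sq_le_sq₀ (norm_nonneg _) (by positivity)).1 ?_
  rw [mul_pow, Real.sq_sqrt hS0, EuclideanSpace.norm_sq_eq, hS, Finset.sum_comm, Finset.sum_mul]
  refine Finset.sum_le_sum fun j _ => ?_
  have hv : L v j = ∑ i, L (EuclideanSpace.single i 1) j * v i := by
    conv_lhs => rw [← (EuclideanSpace.basisFun (Fin d) ℝ).sum_repr v]
    simp [mul_comm]
  rw [hv, Real.norm_eq_abs, sq_abs, EuclideanSpace.norm_sq_eq]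
  simpa using Finset.sum_mul_sq_le_sq_mul_sq Finset.univ
    (fun i => L (EuclideanSpace.single i 1) j) (fun i => v i)

/-- Two integrations by parts exchange the derivatives in a product of first derivatives. -/
lemma integral_fderiv_mul_fderiv_swap {φ : Euc d → Euc d} (hφ : ContDiff ℝ (⊤ : ℕ∞) φ)
    {C₀ C₁ C₂ : ℝ} (h₀ : ∀ x : Euc d, 4 ≤ ‖x‖ → ‖φ x‖ ≤ C₀ * (‖x‖ ^ (d - 1))⁻¹)
    (h₁ : ∀ x : Euc d, 4 ≤ ‖x‖ → ‖fderiv ℝ φ x‖ ≤ C₁ * (‖x‖ ^ d)⁻¹)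
    (h₂ : ∀ x : Euc d, 4 ≤ ‖x‖ → ‖fderiv ℝ (fderiv ℝ φ) x‖ ≤ C₂ * (‖x‖ ^ (d + 1))⁻¹)
    (i j : Fin d) :
    ∫ x, fderiv ℝ φ x (EuclideanSpace.single i 1) j * fderiv ℝ φ x (EuclideanSpace.single j 1) i =
    ∫ x, fderiv ℝ φ x (EuclideanSpace.single i 1) i * fderiv ℝ φ x (EuclideanSpace.single j 1) j := by
  rcases eq_or_ne i j with rfl | hij
  · rfl
  have hd : 2 ≤ d := by
    have := i.2; have := j.2
    have : (i : ℕ) ≠ j := fun h => hij (Fin.ext h)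
    omega
  have hd1 : ContDiff ℝ (⊤ : ℕ∞) (fderiv ℝ φ) := hφ.fderiv_right (by simp)
  have hd2 : ContDiff ℝ (⊤ : ℕ∞) (fderiv ℝ (fderiv ℝ φ)) := hd1.fderiv_right (by simp)
  have c0 := hφ.continuous
  have c1 := hd1.continuous
  have c2 := hd2.continuous
  have hmul : ∀ {a b A B r : ℝ} {m n k : ℕ}, k = m + n → |a| ≤ A * (r ^ m)⁻¹ →
      |b| ≤ B * (r ^ n)⁻¹ → |a * b| ≤ (A * B) * (r ^ k)⁻¹ := by
    rintro a b A B r m n k rfl ha hb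
    rw [abs_mul, pow_add, mul_inv, mul_mul_mul_comm]
    exact mul_le_mul ha hb (abs_nonneg _) ((abs_nonneg _).trans ha)
  -- coordinates of the first and second derivatives
  have e1 : ∀ (a b : Fin d) (x : Euc d), HasFDerivAt (fun y => fderiv ℝ φ y (EuclideanSpace.single a 1) b)
      ((EuclideanSpace.proj b).comp ((ContinuousLinearMap.apply ℝ (Euc d)
        (EuclideanSpace.single a (1 : ℝ))).comp (fderiv ℝ (fderiv ℝ φ) x))) x := by
    intro a b x
    have hx := (hd1.differentiable (by simp) x).hasFDerivAt
    exact ((EuclideanSpace.proj b).comp (ContinuousLinearMap.apply ℝ (Euc d)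
        (EuclideanSpace.single a (1 : ℝ)))).hasFDerivAt.comp x hx
  have e0 : ∀ (b : Fin d) (x : Euc d), HasFDerivAt (fun y => φ y b)
      ((EuclideanSpace.proj b).comp (fderiv ℝ φ x)) x := by
    intro b x
    exact (EuclideanSpace.proj b).hasFDerivAt.comp x (hφ.differentiable (by simp) x).hasFDerivAt
  have parts : ∀ (v b : Fin d), 
      ∫ x, fderiv ℝ φ x (EuclideanSpace.single v 1) j * fderiv ℝ φ x (EuclideanSpace.single b 1) i =
      - ∫ x, φ x j * fderiv ℝ (fderiv ℝ φ) x (EuclideanSpace.single v 1)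
        (EuclideanSpace.single b 1) i := by
    intro v b
    have key := integral_mul_fderiv_eq_neg_fderiv_mul_of_integrable (μ := (volume : Measure (Euc d)))
      (f := fun x => φ x j) (g := fun x => fderiv ℝ φ x (EuclideanSpace.single b 1) i)
      (v := EuclideanSpace.single v 1) ?_ ?_ ?_ (fun x _ => (e0 j x).differentiableAt)
      (fun x _ => (e1 b i x).differentiableAt)
    · simp only [(e0 j _).fderiv, (e1 b i _).fderiv] at key
      simp only [ContinuousLinearMap.comp_apply, ContinuousLinearMap.apply_apply,
        PiLp.proj_apply] at key
      rw [key, neg_neg]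
    · simp only [(e0 j _).fderiv]
      refine integrable_of_decay (m := d + d) (C := C₁ * C₁) (by fun_prop) (by omega) fun x hx => ?_
      exact hmul rfl ((abs_apply_single_le _ v j).trans (h₁ x hx))
        ((abs_apply_single_le _ b i).trans (h₁ x hx))
    · simp only [(e1 b i _).fderiv]
      refine integrable_of_decay (m := d + d) (C := C₀ * C₂) (by fun_prop) (by omega) fun x hx => ?_
      refine hmul (by omega) ((abs_coord_le _ j).trans (h₀ x hx)) ?_ (m := d - 1) (n := d + 1)
      refine (abs_apply_single_le _ b i).trans (le_trans ?_ (h₂ x hx))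
      simpa using (fderiv ℝ (fderiv ℝ φ) x).le_opNorm (EuclideanSpace.single v (1 : ℝ))
    · refine integrable_of_decay (m := d - 1 + d) (C := C₀ * C₁) (by fun_prop) (by omega)
        fun x hx => ?_
      exact hmul rfl ((abs_coord_le _ j).trans (h₀ x hx))
        ((abs_apply_single_le _ b i).trans (h₁ x hx))
  rw [parts i j]
  have : ∀ x, fderiv ℝ (fderiv ℝ φ) x (EuclideanSpace.single i 1) (EuclideanSpace.single j 1) =
      fderiv ℝ (fderiv ℝ φ) x (EuclideanSpace.single j 1) (EuclideanSpace.single i 1) := fun x =>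
    ((contDiff_infty.1 hφ 2).contDiffAt.isSymmSndFDerivAt (by simp)) _ _
  simp only [this]
  rw [← parts j i]
  simp only [mul_comm]

lemma cnv_rieszD_symm (hs : 0 < s) (hI : Integrable h)
    (h0 : ∀ y, y ∉ closedBall (0 : Euc d) 1 → h y = 0) (x : Euc d) (i j : Fin d) :
    cnv h (rieszD s) x (EuclideanSpace.single i 1) j =
      cnv h (rieszD s) x (EuclideanSpace.single j 1) i := by
  have key : ∀ i j : Fin d, cnv h (rieszD s) x (EuclideanSpace.single i 1) j =
      cnv h (fun z => rieszD s z (EuclideanSpace.single i 1) j) x := fun i j =>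
    clm_cnv hI h0 (contDiff_rieszD hs).continuous ((EuclideanSpace.proj j).comp
      (ContinuousLinearMap.apply ℝ (Euc d) (EuclideanSpace.single i (1 : ℝ)))) x
  rw [key, key]
  simp only [rieszD_apply_symm s _ i j]

lemma sum_cnv_rieszD (hs : 0 < s) (hI : Integrable h)
    (h0 : ∀ y, y ∉ closedBall (0 : Euc d) 1 → h y = 0) (x : Euc d) :
    ∑ i, cnv h (rieszD s) x (EuclideanSpace.single i 1) i = cnv h (poisson s) x := by
  have key := clm_cnv hI h0 (contDiff_rieszD hs).continuous
    (∑ i, (EuclideanSpace.proj i).comp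
      (ContinuousLinearMap.apply ℝ (Euc d) (EuclideanSpace.single i (1 : ℝ)))) x
  simp only [_root_.sum_apply, ContinuousLinearMap.comp_apply,
    ContinuousLinearMap.apply_apply, PiLp.proj_apply, sum_rieszD_apply hs] at key
  exact key

lemma abs_cnv_poisson_le (hs : 0 < s) (hb : ∀ y, |h y| ≤ 1) (x : Euc d) :
    |cnv h (poisson s) x| ≤ ∫ z : Euc d, poisson 1 z := by
  rw [← integral_poisson hs, ← integral_sub_left_eq_self (poisson s) volume x, ← Real.norm_eq_abs]
  refine norm_integral_le_of_norm_le ((integrable_poisson hs).comp_sub_left x)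
    (Filter.Eventually.of_forall fun y => ?_)
  rw [norm_smul, Real.norm_of_nonneg (poisson_nonneg s _)]
  exact mul_le_of_le_one_left (poisson_nonneg s _) (hb y)

lemma integral_cnv_poisson_sq_le (hs : 0 < s) (hI : Integrable h)
    (h0 : ∀ y, y ∉ closedBall (0 : Euc d) 1 → h y = 0) (hb : ∀ y, |h y| ≤ 1) :
    ∫ x : Euc d, (cnv h (poisson s) x) ^ 2 ≤
      (∫ z : Euc d, poisson 1 z) ^ 2 * (volume.real (closedBall (0 : Euc d) 1)) := by
  set Q := ∫ z : Euc d, poisson 1 z with hQ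
  have hQ0 : 0 ≤ Q := integral_nonneg fun z => poisson_nonneg 1 z
  have hI' : Integrable (fun y => |h y|) := hI.abs
  have h1 : Integrable (cnv (fun y => |h y|) (poisson s)) :=
    hI'.integrable_convolution (ContinuousLinearMap.lsmul ℝ ℝ) (integrable_poisson hs)
  have h2 : ∫ x, cnv (fun y => |h y|) (poisson s) x = (∫ y, |h y|) * Q := by
    rw [cnv_eq_convolution, integral_convolution _ hI' (integrable_poisson hs), integral_poisson hs]
    simp [hQ]
  have h3 : ∫ y, |h y| ≤ volume.real (closedBall (0 : Euc d) 1) := by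
    have : ∫ y, |h y| ≤ ∫ y, (closedBall (0 : Euc d) 1).indicator (fun _ => (1 : ℝ)) y := by
      refine integral_mono_of_nonneg (Filter.Eventually.of_forall fun y => abs_nonneg _) ?_
        (Filter.Eventually.of_forall fun y => ?_)
      · rw [integrable_indicator_iff measurableSet_closedBall]
        exact integrableOn_const measure_closedBall_lt_top.ne
      · by_cases hy : y ∈ closedBall (0 : Euc d) 1
        · simpa [hy] using hb y
        · simp [hy, h0 y hy]
    refine this.trans (le_of_eq ?_)
    rw [integral_indicator measurableSet_closedBall]
    simp [Measure.real]
  calc ∫ x : Euc d, (cnv h (poisson s) x) ^ 2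
      ≤ ∫ x, Q * cnv (fun y => |h y|) (poisson s) x := by
        refine integral_mono_of_nonneg (Filter.Eventually.of_forall fun y => sq_nonneg _)
          (h1.const_mul Q) (Filter.Eventually.of_forall fun x => ?_)
        have e1 := abs_cnv_poisson_le hs hb x
        have e2 : |cnv h (poisson s) x| ≤ cnv (fun y => |h y|) (poisson s) x := by
          unfold cnv
          refine (abs_integral_le_integral_abs).trans (le_of_eq ?_)
          congr 1
          ext y
          rw [smul_eq_mul, abs_mul, abs_of_nonneg (poisson_nonneg s _), smul_eq_mul]
        simp only
        rw [← sq_abs, sq]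
        exact mul_le_mul e1 e2 (abs_nonneg _) hQ0
    _ = Q * ((∫ y, |h y|) * Q) := by rw [integral_const_mul, h2]
    _ ≤ Q * (volume.real (closedBall (0 : Euc d) 1) * Q) := by gcongr
    _ = _ := by ring

lemma norm_cnv_rieszD_decay (hs : 0 < s) (hI : Integrable h)
    (h0 : ∀ y, y ∉ closedBall (0 : Euc d) 1 → h y = 0) : ∃ C : ℝ, ∀ x : Euc d, 4 ≤ ‖x‖ →
      ‖cnv h (rieszD s) x‖ ≤ C * (‖x‖ ^ d)⁻¹ := by
  refine ⟨_, fun x hx => norm_cnv_decay hI h0 (c := d + 1) (m := d) (by positivity)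
    (fun z hz => ?_) hx⟩
  refine (norm_rieszD_le hs z).trans ?_
  have := norm_pos_iff.2 hz
  have := norm_le_bracket s z
  gcongr

lemma exists_integral_cnv_rieszD_sq_le (hd : 0 < d) : ∃ B : ℝ, 0 < B ∧ ∀ s : ℝ, 0 < s →
    ∀ h : Euc d → ℝ, Integrable h → (∀ y, y ∉ closedBall (0 : Euc d) 1 → h y = 0) →
    (∀ y, |h y| ≤ 1) → ∫⁻ x, ENNReal.ofReal (‖cnv h (rieszD s) x‖ ^ 2) ≤ ENNReal.ofReal B := by
  set B := (∫ z : Euc d, poisson 1 z) ^ 2 * (volume.real (closedBall (0 : Euc d) 1)) with hB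
  refine ⟨B + 1, by positivity, fun s hs h hI h0 hb => ?_⟩
  obtain ⟨C₁, hC₁⟩ := norm_cnv_rieszD_decay hs hI h0
  obtain ⟨C₂, hC₂⟩ := norm_fderiv_cnv_rieszD_decay hs hI h0
  have hfd : fderiv ℝ (cnv h (riesz s)) = cnv h (rieszD s) :=
    funext fun x => (hasFDerivAt_cnv_riesz hs hI h0 x).fderiv
  have hc : Continuous (cnv h (rieszD s)) := (contDiff_cnv hI h0 (contDiff_rieszD hs)).continuous
  have hInt : ∀ a b i j : Fin d, Integrable (fun x => cnv h (rieszD s) x (EuclideanSpace.single a 1) b *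
      cnv h (rieszD s) x (EuclideanSpace.single i 1) j) := by
    intro a b i j
    refine integrable_of_decay (m := d + d) (C := C₁ * C₁) (by fun_prop) (by omega) fun x hx => ?_
    rw [abs_mul, pow_add, mul_inv, mul_mul_mul_comm]
    have h1 := (abs_apply_single_le (cnv h (rieszD s) x) a b).trans (hC₁ x hx)
    have h2 := (abs_apply_single_le (cnv h (rieszD s) x) i j).trans (hC₁ x hx)
    exact mul_le_mul h1 h2 (abs_nonneg _) ((abs_nonneg _).trans h1)
  have hswap : ∀ i j : Fin d, ∫ x, (cnv h (rieszD s) x (EuclideanSpace.single i 1) j) ^ 2 =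
      ∫ x, cnv h (rieszD s) x (EuclideanSpace.single i 1) i *
        cnv h (rieszD s) x (EuclideanSpace.single j 1) j := by
    intro i j
    have key := integral_fderiv_mul_fderiv_swap (contDiff_cnv hI h0 (contDiff_riesz hs))
      (fun x hx => norm_cnv_decay hI h0 zero_le_one (m := d - 1)
        (fun z _ => by rw [one_mul]; exact norm_riesz_le s hd z) hx)
      (by rw [hfd]; exact hC₁) (by rw [hfd]; exact hC₂) i j
    rw [hfd] at key
    rw [← key]
    simp only [cnv_rieszD_symm hs hI h0 _ j i, sq]
  have hsum : Integrable (fun x => ∑ i, ∑ j, (cnv h (rieszD s) x (EuclideanSpace.single i 1) j) ^ 2) :=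
    integrable_finsetSum _ fun i _ => integrable_finsetSum _ fun j _ => by
      simpa only [sq] using hInt i j i j
  calc ∫⁻ x, ENNReal.ofReal (‖cnv h (rieszD s) x‖ ^ 2)
      ≤ ∫⁻ x, ENNReal.ofReal (∑ i, ∑ j, (cnv h (rieszD s) x (EuclideanSpace.single i 1) j) ^ 2) :=
        lintegral_mono fun x => ENNReal.ofReal_le_ofReal (norm_sq_le_sum_sq _)
    _ = ENNReal.ofReal
          (∫ x, ∑ i, ∑ j, (cnv h (rieszD s) x (EuclideanSpace.single i 1) j) ^ 2) := by
        rw [ofReal_integral_eq_lintegral_ofReal hsum]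
        exact Filter.Eventually.of_forall fun x =>
          Finset.sum_nonneg fun i _ => Finset.sum_nonneg fun j _ => sq_nonneg _
    _ = ENNReal.ofReal (∫ x, (cnv h (poisson s) x) ^ 2) := by
        congr 1
        simp only [← sum_cnv_rieszD hs hI h0, sq, Finset.sum_mul_sum]
        simp only [← sq]
        rw [integral_finsetSum _ fun i _ => integrable_finsetSum _ fun j _ => by
            simpa only [sq] using hInt i j i j,
          integral_finsetSum _ fun i _ => integrable_finsetSum _ fun j _ => hInt i i j j]
        refine Finset.sum_congr rfl fun i _ => ?_
        rw [integral_finsetSum _ fun j _ => by simpa only [sq] using hInt i j i j,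
          integral_finsetSum _ fun j _ => hInt i i j j]
        exact Finset.sum_congr rfl fun j _ => hswap i j
    _ ≤ ENNReal.ofReal (B + 1) :=
        ENNReal.ofReal_le_ofReal ((integral_cnv_poisson_sq_le hs hI h0 hb).trans (by linarith))

lemma uniformContinuous_cnv_rieszD (hd : 0 < d) (hs : 0 < s) (hI : Integrable h)
    (h0 : ∀ y, y ∉ closedBall (0 : Euc d) 1 → h y = 0) :
    UniformContinuous (cnv h (rieszD s)) := by
  obtain ⟨C₁, hC₁⟩ := norm_cnv_rieszD_decay hs hI h0
  refine (contDiff_cnv hI h0 (contDiff_rieszD hs)).continuous.uniformContinuous_of_tendsto_cocompact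
    (x := 0) ?_
  rw [tendsto_zero_iff_norm_tendsto_zero]
  have h1 : Filter.Tendsto (fun x : Euc d => C₁ * (‖x‖ ^ d)⁻¹) (Filter.cocompact _) (nhds 0) := by
    have := ((Filter.tendsto_pow_atTop hd.ne').comp
      (tendsto_norm_cocompact_atTop (E := Euc d))).inv_tendsto_atTop.const_mul C₁
    simpa using this
  refine squeeze_zero' (Filter.Eventually.of_forall fun x => norm_nonneg _) ?_ h1
  filter_upwards [tendsto_norm_cocompact_atTop (E := Euc d) (Filter.eventually_ge_atTop 4)] with x hx
    using hC₁ x hx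

end energy

section maximal

variable {d : ℕ}

/-- A substitute for the Calderón–Zygmund decomposition: the square integral of a function with
controlled oscillation against a measure with density bound on `F`. -/
lemma lintegral_norm_sq_le {G : Type*} [NormedAddCommGroup G]
    {Φ : Euc d → G} (hΦ : UniformContinuous Φ) {F : Set (Euc d)} (hF : IsClosed F)
    (hFne : F.Nonempty) {A : ℝ} (hA : 1 ≤ A)
    (hosc : ∀ x x', dist x x' < infDist x F / 4 → ‖Φ x - Φ x'‖ ≤ A)
    {τ : Measure (Euc d)} [IsFiniteMeasure τ] {l : ℝ}
    (hτ : ∀ x ∈ F, ∀ r : ℝ, 0 < r → τ (ball x r) ≤ ENNReal.ofReal (l * r ^ d)) :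
    ∫⁻ x, ENNReal.ofReal (‖Φ x‖ ^ 2) ∂τ ≤ ENNReal.ofReal (2 * A ^ 2) * τ Set.univ +
      2 * (ENNReal.ofReal (l * 12 ^ d / volume.real (ball (0 : Euc d) 1)) *
        ∫⁻ y, ENNReal.ofReal (‖Φ y‖ ^ 2)) := by
  obtain ⟨δ, hδ, hδΦ⟩ := Metric.uniformContinuous_iff.1 hΦ 1 one_pos
  set R : Euc d → ℝ := fun x => max δ (infDist x F / 4) with hR
  set v := volume.real (ball (0 : Euc d) 1) with hv
  have hv0 : 0 < v :=
    ENNReal.toReal_pos (measure_ball_pos _ _ one_pos).ne' measure_ball_lt_top.ne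
  have hRpos : ∀ x, 0 < R x := fun x => lt_max_of_lt_left hδ
  have hRc : Continuous R := by
    have := continuous_infDist_pt F
    fun_prop
  have hRlip : ∀ x y, R x ≤ R y + dist x y / 4 := by
    intro x y
    have := infDist_le_infDist_add_dist (s := F) (x := x) (y := y)
    refine max_le ?_ ?_
    · linarith [le_max_left δ (infDist y F / 4), dist_nonneg (x := x) (y := y)]
    · linarith [le_max_right δ (infDist y F / 4)]
  have hoscR : ∀ x y, dist x y < R x → ‖Φ x - Φ y‖ ≤ A := by
    intro x y hxy
    rcases lt_max_iff.1 hxy with h | h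
    · rw [← dist_eq_norm]; exact (hδΦ h).le.trans hA
    · exact hosc x y h
  have hvol : ∀ x, volume (ball x (R x)) = ENNReal.ofReal (R x ^ d * v) := by
    intro x
    rw [Measure.addHaar_ball_of_pos _ _ (hRpos x), finrank_euclideanSpace, Fintype.card_fin,
      ENNReal.ofReal_mul (by have := hRpos x; positivity), hv, ofReal_measureReal]
  set u : Euc d → ENNReal := fun y => ENNReal.ofReal (‖Φ y‖ ^ 2) with hu
  have huc : Continuous u := by
    have := hΦ.continuous
    exact ENNReal.continuous_ofReal.comp (by fun_prop)
  set W : Euc d → ENNReal := fun x => ENNReal.ofReal ((R x ^ d * v)⁻¹) with hW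
  have hWc : Continuous W := by
    refine ENNReal.continuous_ofReal.comp (Continuous.inv₀ (by fun_prop) fun x => ?_)
    have := hRpos x
    positivity
  have hpt : ∀ x, u x ≤ ENNReal.ofReal (2 * A ^ 2) +
      2 * (W x * ∫⁻ y in ball x (R x), u y) := by
    intro x
    have hx : u x * volume (ball x (R x)) ≤
        ENNReal.ofReal (2 * A ^ 2) * volume (ball x (R x)) + 2 * ∫⁻ y in ball x (R x), u y := by
      rw [← lintegral_const_mul _ huc.measurable, ← setLIntegral_const, ← setLIntegral_const,
        ← lintegral_add_left measurable_const]
      refine setLIntegral_mono (by fun_prop) fun y hy => ?_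
      have h1 := hoscR x y (by rw [dist_comm]; exact hy)
      have h2 : ‖Φ x‖ ≤ A + ‖Φ y‖ := by
        have := norm_le_norm_add_norm_sub' (Φ x) (Φ y)
        linarith
      simp only [hu]
      rw [show (2 : ENNReal) = ENNReal.ofReal 2 by simp, ← ENNReal.ofReal_mul (by norm_num),
        ← ENNReal.ofReal_add (by positivity) (by positivity)]
      refine ENNReal.ofReal_le_ofReal ?_
      nlinarith [sq_nonneg (A - ‖Φ y‖), norm_nonneg (Φ x), norm_nonneg (Φ y)]
    have hWv : volume (ball x (R x)) * W x = 1 := by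
      have := hRpos x
      rw [hvol, hW, ← ENNReal.ofReal_mul (by positivity), mul_inv_cancel₀ (by positivity),
        ENNReal.ofReal_one]
    calc u x = u x * volume (ball x (R x)) * W x := by rw [mul_assoc, hWv, mul_one]
      _ ≤ (ENNReal.ofReal (2 * A ^ 2) * volume (ball x (R x)) +
          2 * ∫⁻ y in ball x (R x), u y) * W x := by gcongr
      _ = _ := by rw [add_mul, mul_assoc, hWv, mul_one]; ring
  set E : Set (Euc d × Euc d) := {p | dist p.2 p.1 < R p.1} with hE
  have hEm : MeasurableSet E := (isOpen_lt (by fun_prop) (by fun_prop)).measurableSet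
  have hN : ∀ y, ∫⁻ x, E.indicator (fun p => W p.1) (x, y) ∂τ ≤
      ENNReal.ofReal (l * 12 ^ d / v) := by
    intro y
    obtain ⟨z, hzF, hz⟩ := hF.exists_infDist_eq_dist hFne y
    have hRy := hRpos y
    have hz4 : dist y z ≤ 4 * R y := by
      rw [← hz]
      linarith [le_max_right δ (infDist y F / 4)]
    calc ∫⁻ x, E.indicator (fun p => W p.1) (x, y) ∂τ
        ≤ ∫⁻ x, (ball z (6 * R y)).indicator
          (fun _ => ENNReal.ofReal (((R y / 2) ^ d * v)⁻¹)) x ∂τ := by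
          refine lintegral_mono fun x => ?_
          by_cases hx : (x, y) ∈ E
          · have hx' : dist y x < R x := hx
            have h1 := hRlip x y
            have h2 := hRlip y x
            rw [dist_comm] at h1
            have hx3 : dist x z ≤ dist y x + dist y z := by
              rw [dist_comm y x]; exact dist_triangle _ _ _
            have hmem : x ∈ ball z (6 * R y) := by
              rw [mem_ball]
              linarith
            rw [Set.indicator_of_mem hx, Set.indicator_of_mem hmem]
            refine ENNReal.ofReal_le_ofReal ?_
            have : R y / 2 ≤ R x := by linarith
            simp only
            gcongr
          · rw [Set.indicator_of_notMem hx]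
            exact zero_le
      _ = ENNReal.ofReal (((R y / 2) ^ d * v)⁻¹) * τ (ball z (6 * R y)) := by
          rw [lintegral_indicator measurableSet_ball, setLIntegral_const]
      _ ≤ ENNReal.ofReal (((R y / 2) ^ d * v)⁻¹) * ENNReal.ofReal (l * (6 * R y) ^ d) := by
          gcongr
          exact hτ z hzF _ (by positivity)
      _ = _ := by
          rw [← ENNReal.ofReal_mul (by positivity)]
          congr 1
          rw [show (12 : ℝ) = 6 * 2 by norm_num, mul_pow, mul_pow, div_pow]
          field_simp
  calc ∫⁻ x, u x ∂τ
      ≤ ∫⁻ x, (ENNReal.ofReal (2 * A ^ 2) + 2 * (W x * ∫⁻ y in ball x (R x), u y)) ∂τ :=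
        lintegral_mono hpt
    _ = ENNReal.ofReal (2 * A ^ 2) * τ Set.univ +
        2 * ∫⁻ x, (W x * ∫⁻ y in ball x (R x), u y) ∂τ := by
        rw [lintegral_add_left measurable_const, lintegral_const,
          lintegral_const_mul' _ _ (by simp)]
    _ = ENNReal.ofReal (2 * A ^ 2) * τ Set.univ +
        2 * ∫⁻ x, (∫⁻ y, E.indicator (fun p => W p.1) (x, y) * u y) ∂τ := by
        congr 2
        refine lintegral_congr fun x => ?_
        rw [← lintegral_const_mul _ huc.measurable, ← lintegral_indicator measurableSet_ball]
        refine lintegral_congr fun y => ?_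
        by_cases hy : y ∈ ball x (R x)
        · have : (x, y) ∈ E := hy
          simp [hy, this]
        · have : (x, y) ∉ E := hy
          simp [hy, this]
    _ = ENNReal.ofReal (2 * A ^ 2) * τ Set.univ +
        2 * ∫⁻ y, (∫⁻ x, E.indicator (fun p => W p.1) (x, y) ∂τ) * u y := by
        have hm : Measurable (E.indicator (fun p : Euc d × Euc d => W p.1)) :=
          (hWc.measurable.comp measurable_fst).indicator hEm
        rw [lintegral_lintegral_swap]
        · congr 2
          refine lintegral_congr fun y => ?_
          rw [lintegral_mul_const]
          exact hm.comp (by fun_prop)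
        · exact (hm.mul (huc.measurable.comp measurable_snd)).aemeasurable
    _ ≤ ENNReal.ofReal (2 * A ^ 2) * τ Set.univ +
        2 * ∫⁻ y, ENNReal.ofReal (l * 12 ^ d / v) * u y := by
        gcongr with y
        exact hN y
    _ = _ := by rw [lintegral_const_mul _ huc.measurable]

lemma lintegral_norm_le_add {G : Type*} [NormedAddCommGroup G] {Φ : Euc d → G}
    (τ : Measure (Euc d)) {κ : ℝ} (hκ : 0 < κ) :
    ∫⁻ x, ENNReal.ofReal ‖Φ x‖ ∂τ ≤ ENNReal.ofReal (1 / (4 * κ)) * τ Set.univ +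
      ENNReal.ofReal κ * ∫⁻ x, ENNReal.ofReal (‖Φ x‖ ^ 2) ∂τ := by
  rw [← lintegral_const, ← lintegral_const_mul' _ _ ENNReal.ofReal_ne_top,
    ← lintegral_add_left measurable_const]
  refine lintegral_mono fun x => ?_
  rw [← ENNReal.ofReal_mul hκ.le, ← ENNReal.ofReal_add (by positivity) (by positivity)]
  refine ENNReal.ofReal_le_ofReal ?_
  have h : 1 / (4 * κ) + κ * ‖Φ x‖ ^ 2 - ‖Φ x‖ = κ * (‖Φ x‖ - 1 / (2 * κ)) ^ 2 := by
    field_simp; ring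
  nlinarith [mul_nonneg hκ.le (sq_nonneg (‖Φ x‖ - 1 / (2 * κ)))]

/-- The set of points at which all balls have `ω`-density at most `l`. -/
def lowDensity (ω : Measure (Euc d)) (l : ℝ) : Set (Euc d) :=
  {x | ∀ r : ℝ, 0 < r → ω (ball x r) ≤ ENNReal.ofReal (l * r ^ d)}

lemma isClosed_lowDensity (ω : Measure (Euc d)) (l : ℝ) : IsClosed (lowDensity ω l) := by
  refine isClosed_of_closure_subset fun x hx r hr => ?_
  have hlim : Filter.Tendsto (fun e : ℝ => ENNReal.ofReal (l * (r + e) ^ d)) (nhdsWithin 0 (Set.Ioi 0))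
      (nhds (ENNReal.ofReal (l * r ^ d))) := by
    have : Continuous (fun e : ℝ => ENNReal.ofReal (l * (r + e) ^ d)) :=
      ENNReal.continuous_ofReal.comp (by fun_prop)
    simpa using (this.tendsto 0).mono_left nhdsWithin_le_nhds
  refine ge_of_tendsto hlim ?_
  filter_upwards [self_mem_nhdsWithin] with e he
  obtain ⟨x', hx', hxx'⟩ := Metric.mem_closure_iff.1 hx e he
  refine (measure_mono ?_).trans (hx' (r + e) (add_pos hr he))
  exact ball_subset_ball' (by linarith)

lemma volume_compl_lowDensity_le (hd : 0 < d) (ω : Measure (Euc d)) [IsFiniteMeasure ω] {l : ℝ}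
    (hl : 0 < l) : ENNReal.ofReal l * volume (lowDensity ω l)ᶜ ≤
      ENNReal.ofReal (5 ^ d * volume.real (ball (0 : Euc d) 1)) * ω Set.univ := by
  set v := volume.real (ball (0 : Euc d) 1) with hv
  have hv0 : 0 < v :=
    ENNReal.toReal_pos (measure_ball_pos _ _ one_pos).ne' measure_ball_lt_top.ne
  have h : ∀ x : Euc d, ∃ r : ℝ, x ∈ (lowDensity ω l)ᶜ →
      0 < r ∧ ENNReal.ofReal (l * r ^ d) < ω (ball x r) := by
    intro x
    by_cases hx : x ∈ lowDensity ω l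
    · exact ⟨0, fun h => absurd hx h⟩
    · simp only [lowDensity, Set.mem_ofPred_eq, not_forall, not_le] at hx
      obtain ⟨r, hr, h⟩ := hx
      exact ⟨r, fun _ => ⟨hr, h⟩⟩
  choose r hr using h
  have hbd : ∀ x ∈ (lowDensity ω l)ᶜ, r x ≤ max 1 (ω.real Set.univ / l) := by
    intro x hx
    obtain ⟨h0, h1⟩ := hr x hx
    have h2 : l * r x ^ d ≤ ω.real Set.univ := by
      have := (h1.le.trans (measure_mono (Set.subset_univ _)))
      exact (ENNReal.ofReal_le_iff_le_toReal (measure_ne_top _ _)).1 this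
    rcases le_total (r x) 1 with h3 | h3
    · exact le_max_of_le_left h3
    · refine le_max_of_le_right ?_
      rw [le_div_iff₀ hl, mul_comm]
      refine le_trans ?_ h2
      gcongr
      exact le_self_pow₀ h3 hd.ne'
  obtain ⟨u, hut, hudisj, hucov⟩ := Vitali.exists_disjoint_subfamily_covering_enlargement_closedBall
    (lowDensity ω l)ᶜ (fun x => x) r _ hbd 5 (by norm_num)
  have hucount : u.Countable := by
    refine hudisj.countable_of_nonempty_interior fun x hx => ?_
    exact ⟨x, ball_subset_interior_closedBall (mem_ball_self (hr x (hut hx)).1)⟩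
  have hcov : (lowDensity ω l)ᶜ ⊆ ⋃ x ∈ u, closedBall x (5 * r x) := by
    intro x hx
    obtain ⟨b, hb, hsub⟩ := hucov x hx
    exact Set.mem_biUnion hb (hsub (mem_closedBall_self (hr x hx).1.le))
  have := hucount.to_subtype
  calc ENNReal.ofReal l * volume (lowDensity ω l)ᶜ
      ≤ ENNReal.ofReal l * ∑' x : u, volume (closedBall (x : Euc d) (5 * r x)) := by
        gcongr
        exact (measure_mono hcov).trans (measure_biUnion_le _ hucount _)
    _ = ∑' x : u, ENNReal.ofReal (5 ^ d * v) * ENNReal.ofReal (l * r x ^ d) := by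
        rw [← ENNReal.tsum_mul_left]
        refine tsum_congr fun x => ?_
        have h0 := (hr x (hut x.2)).1
        rw [Measure.addHaar_closedBall _ _ (by positivity), finrank_euclideanSpace,
          Fintype.card_fin, ← ofReal_measureReal (s := ball (0 : Euc d) 1), ← hv,
          ← ENNReal.ofReal_mul (by positivity), ← ENNReal.ofReal_mul (by positivity),
          ← ENNReal.ofReal_mul (by positivity)]
        congr 1
        ring
    _ ≤ ∑' x : u, ENNReal.ofReal (5 ^ d * v) * ω (closedBall (x : Euc d) (r x)) := by
        gcongr with x
        exact (hr x (hut x.2)).2.le.trans (measure_mono ball_subset_closedBall)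
    _ = ENNReal.ofReal (5 ^ d * v) * ω (⋃ x ∈ u, closedBall x (r x)) := by
        rw [ENNReal.tsum_mul_left, measure_biUnion hucount hudisj
          fun x _ => measurableSet_closedBall]
    _ ≤ _ := by gcongr; exact Set.subset_univ _

lemma measure_lowDensity_eq_zero {ω σ : Measure (Euc d)} [IsFiniteMeasure σ] (hσω : σ ≤ ω)
    (hσ : σ.MutuallySingular volume) {l : ℝ} (hl : 0 < l) : σ (lowDensity ω l) = 0 := by
  set v := volume.real (ball (0 : Euc d) 1) with hv
  have hv0 : 0 < v :=
    ENNReal.toReal_pos (measure_ball_pos _ _ one_pos).ne' measure_ball_lt_top.ne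
  have h1 := Besicovitch.ae_tendsto_rnDeriv (volume : Measure (Euc d)) σ
  have h2 := Measure.MutuallySingular.rnDeriv_ae_eq_zero hσ.symm
  suffices ∀ᵐ x ∂σ, x ∉ lowDensity ω l by
    rw [ae_iff] at this
    simpa using this
  filter_upwards [h1, h2] with x hx hx0 hxF
  rw [hx0] at hx
  have hpos : (0 : ENNReal) < ENNReal.ofReal (v / (l * 2 ^ d)) := by
    rw [ENNReal.ofReal_pos]; positivity
  refine absurd (ge_of_tendsto hx (b := ENNReal.ofReal (v / (l * 2 ^ d))) ?_) (not_le.2 hpos)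
  filter_upwards [self_mem_nhdsWithin] with r hr
  have hr : 0 < r := hr
  have hvol : volume (closedBall x r) = ENNReal.ofReal (r ^ d * v) := by
    rw [Measure.addHaar_closedBall _ _ hr.le, finrank_euclideanSpace, Fintype.card_fin,
      ENNReal.ofReal_mul (by positivity), hv, ofReal_measureReal]
  rw [hvol, ENNReal.le_div_iff_mul_le (Or.inr (ENNReal.ofReal_pos.2 (by positivity)).ne')
    (Or.inr ENNReal.ofReal_ne_top)]
  have h3 : σ (closedBall x r) ≤ ENNReal.ofReal (l * (2 * r) ^ d) :=
    (hσω _).trans ((measure_mono (closedBall_subset_ball (by linarith))).trans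
      (hxF (2 * r) (by positivity)))
  calc _ ≤ ENNReal.ofReal (v / (l * 2 ^ d)) * ENNReal.ofReal (l * (2 * r) ^ d) := by gcongr
    _ = _ := by
      rw [← ENNReal.ofReal_mul (by positivity)]
      congr 1
      rw [mul_pow]
      field_simp

end maximal

section smallness

variable {d : ℕ} {s : ℝ}

lemma exists_norm_cnv_rieszD_le (hd : 0 < d) {ψ : Euc d → ℝ} (hψ : ContDiff ℝ (⊤ : ℕ∞) ψ)
    (h0 : tsupport ψ ⊆ closedBall (0 : Euc d) 1) :
    ∃ M : ℝ, 0 < M ∧ ∀ s : ℝ, 0 < s → ∀ x, ‖cnv ψ (rieszD s) x‖ ≤ M := by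
  have hcs : HasCompactSupport ψ :=
    (isCompact_closedBall (0 : Euc d) 1).of_isClosed_subset (isClosed_tsupport ψ) h0
  have h0' : ∀ y, y ∉ closedBall (0 : Euc d) 1 → ψ y = 0 := fun y hy =>
    image_eq_zero_of_notMem_tsupport fun h => hy (h0 h)
  have hI : Integrable ψ := hψ.continuous.integrable_of_hasCompactSupport hcs
  obtain ⟨C, hC, hCb⟩ := exists_lintegral_riesz_closedBall_le hd
  obtain ⟨M, hM⟩ := (hcs.fderiv ℝ).exists_bound_of_continuous (hψ.continuous_fderiv (by simp))
  refine ⟨(|M| + 1) * C, by positivity, fun s hs x => ?_⟩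
  have e : cnv ψ (rieszD s) x = convolution (fderiv ℝ ψ) (riesz s)
      ((ContinuousLinearMap.lsmul ℝ ℝ).precompL (Euc d)) volume x :=
    (hasFDerivAt_cnv_riesz hs hI h0' x).unique
      (hcs.hasFDerivAt_convolution_left (ContinuousLinearMap.lsmul ℝ ℝ)
        (hψ.of_le (by exact_mod_cast le_top)) (contDiff_riesz hs).continuous.locallyIntegrable x)
  rw [e]
  have key : ‖convolution (fderiv ℝ ψ) (riesz s)
      ((ContinuousLinearMap.lsmul ℝ ℝ).precompL (Euc d)) volume x‖ₑ ≤
      ENNReal.ofReal ((|M| + 1) * C) := by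
    unfold convolution
    refine (enorm_integral_le_lintegral_enorm _).trans ?_
    rw [ENNReal.ofReal_mul (by positivity)]
    refine le_trans ?_ (mul_le_mul_right (hCb x) _)
    rw [← lintegral_const_mul' _ _ ENNReal.ofReal_ne_top, ← lintegral_indicator measurableSet_closedBall]
    refine lintegral_mono fun y => ?_
    by_cases hy : y ∈ closedBall (0 : Euc d) 1
    · rw [Set.indicator_of_mem hy, ← ofReal_norm, ← ENNReal.ofReal_mul (by positivity)]
      refine ENNReal.ofReal_le_ofReal ?_
      refine ContinuousLinearMap.opNorm_le_bound _ (by positivity) fun v => ?_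
      rw [ContinuousLinearMap.precompL_apply, ContinuousLinearMap.lsmul_apply, norm_smul]
      have h1 := ((fderiv ℝ ψ y).le_opNorm v).trans
        (mul_le_mul_of_nonneg_right ((hM y).trans (le_abs_self M)) (norm_nonneg v))
      have h2 := norm_riesz_le s hd (x - y)
      calc ‖fderiv ℝ ψ y v‖ * ‖riesz s (x - y)‖ ≤ (|M| * ‖v‖) * (‖x - y‖ ^ (d - 1))⁻¹ := by gcongr
        _ ≤ ((|M| + 1) * ‖v‖) * (‖x - y‖ ^ (d - 1))⁻¹ := by gcongr; linarith
        _ = _ := by ring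
    · have : fderiv ℝ ψ y = 0 :=
        image_eq_zero_of_notMem_tsupport fun h => hy (h0 (tsupport_fderiv_subset ℝ h))
      rw [this, map_zero, ← ofReal_norm]
      simp
  rw [← ofReal_norm] at key
  exact (ENNReal.ofReal_le_ofReal_iff (by positivity)).1 key

lemma contDiff_poisson (hs : 0 < s) : ContDiff ℝ (⊤ : ℕ∞) (poisson s : Euc d → ℝ) := by
  unfold poisson
  exact contDiff_const.mul (((contDiff_bracket hs).pow (d + 2)).inv
    (fun x => (pow_pos (bracket_pos hs x) _).ne'))

lemma le_cnv_poisson (hs : 0 < s) (hs4 : s ≤ 1 / 4) {ψ : Euc d → ℝ} (hI : Integrable ψ)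
    (h0 : ∀ y, y ∉ closedBall (0 : Euc d) 1 → ψ y = 0) (hψ0 : ∀ y, 0 ≤ ψ y)
    (hψ1 : ∀ y ∈ closedBall (0 : Euc d) (1 / 2), ψ y = 1) {x : Euc d}
    (hx : x ∈ closedBall (0 : Euc d) (1 / 4)) :
    d * (2 ^ (d + 2))⁻¹ * volume.real (ball (0 : Euc d) 1) ≤ cnv ψ (poisson s) x := by
  have hvol : volume.real (closedBall x s) = s ^ d * volume.real (ball (0 : Euc d) 1) := by
    rw [Measure.real, Measure.addHaar_closedBall _ _ hs.le, finrank_euclideanSpace,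
      Fintype.card_fin, ENNReal.toReal_mul, ENNReal.toReal_ofReal (by positivity)]
    rfl
  calc d * (2 ^ (d + 2))⁻¹ * volume.real (ball (0 : Euc d) 1)
      = ∫ y, (closedBall x s).indicator (fun _ => (d * s ^ 2 * ((2 * s) ^ (d + 2))⁻¹ : ℝ)) y := by
        rw [integral_indicator measurableSet_closedBall, setIntegral_const, hvol, mul_pow]
        simp only [smul_eq_mul]
        field_simp
        ring
    _ ≤ ∫ y, ψ y • poisson s (x - y) := by
        refine integral_mono ?_ (integrable_cnv hI h0 (continuous_poisson hs) x) fun y => ?_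
        · rw [integrable_indicator_iff measurableSet_closedBall]
          exact integrableOn_const measure_closedBall_lt_top.ne
        · by_cases hy : y ∈ closedBall x s
          · have hy' : ‖x - y‖ ≤ s := by rw [← dist_eq_norm, dist_comm]; exact hy
            have hxn : ‖x‖ ≤ 1 / 4 := by simpa using hx
            have hyn : y ∈ closedBall (0 : Euc d) (1 / 2) := by
              rw [mem_closedBall_zero_iff]
              have := norm_le_norm_add_norm_sub x y
              linarith
            have hb : bracket s (x - y) ≤ 2 * s :=
              Real.sqrt_le_iff.2 ⟨by positivity, by nlinarith [norm_nonneg (x - y)]⟩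
            have hp := bracket_pos hs (x - y)
            rw [Set.indicator_of_mem hy]
            simp only
            rw [hψ1 y hyn, one_smul, poisson]
            gcongr
          · rw [Set.indicator_of_notMem hy]
            exact mul_nonneg (hψ0 y) (poisson_nonneg s _)

lemma abs_cnv_poisson_le_of_ball (hs : 0 < s) {h : Euc d → ℝ}
    (h0 : ∀ y, y ∉ closedBall (0 : Euc d) 1 → h y = 0) (hb : ∀ y, |h y| ≤ 1) {x : Euc d} {r : ℝ}
    (hr : 0 < r) (hxr : ∀ y ∈ ball x r, h y = 0) :
    |cnv h (poisson s) x| ≤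
      d * s ^ 2 * (r ^ (d + 2))⁻¹ * volume.real (closedBall (0 : Euc d) 1) := by
  have e : ∫ y, (closedBall (0 : Euc d) 1).indicator
      (fun _ => (d * s ^ 2 * (r ^ (d + 2))⁻¹ : ℝ)) y =
      d * s ^ 2 * (r ^ (d + 2))⁻¹ * volume.real (closedBall (0 : Euc d) 1) := by
    rw [integral_indicator measurableSet_closedBall, setIntegral_const, smul_eq_mul, mul_comm]
  rw [← e, ← Real.norm_eq_abs]
  refine norm_integral_le_of_norm_le ?_ (Filter.Eventually.of_forall fun y => ?_)
  · rw [integrable_indicator_iff measurableSet_closedBall]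
    exact integrableOn_const measure_closedBall_lt_top.ne
  · by_cases hy : y ∈ closedBall (0 : Euc d) 1
    · rw [Set.indicator_of_mem hy]
      by_cases hyr : y ∈ ball x r
      · simp only [hxr y hyr, zero_smul, norm_zero]
        positivity
      · have h1 : r ≤ bracket s (x - y) := by
          refine le_trans ?_ (norm_le_bracket s _)
          rw [← dist_eq_norm, dist_comm]
          exact not_lt.1 hyr
        rw [norm_smul, Real.norm_of_nonneg (poisson_nonneg s _)]
        refine (mul_le_of_le_one_left (poisson_nonneg s _) (hb y)).trans ?_
        unfold poisson
        gcongr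
    · rw [Set.indicator_of_notMem hy]
      simp [h0 y hy]

lemma tendsto_integral_mul_cnv_poisson {σ : Measure (Euc d)} [IsFiniteMeasure σ] {F : Set (Euc d)}
    (hF : IsClosed F) (hσF : σ F = 0) {χ h : Euc d → ℝ} (hχ : Continuous χ)
    (hχ1 : ∀ x, |χ x| ≤ 1) (hI : Integrable h)
    (h0 : ∀ y, y ∉ closedBall (0 : Euc d) 1 → h y = 0) (hb : ∀ y, |h y| ≤ 1)
    (hF0 : ∀ y, y ∉ F → h y = 0) :
    Filter.Tendsto (fun s : ℝ => ∫ x, χ x * cnv h (poisson s) x ∂σ) (nhdsWithin 0 (Set.Ioi 0))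
      (nhds 0) := by
  have key := tendsto_integral_filter_of_dominated_convergence (μ := σ)
    (l := nhdsWithin (0 : ℝ) (Set.Ioi 0)) (F := fun s x => χ x * cnv h (poisson s) x)
    (f := fun _ => 0) (fun _ => ∫ z : Euc d, poisson 1 z) ?_ ?_ (integrable_const _) ?_
  · simpa using key
  · filter_upwards [self_mem_nhdsWithin] with s hs
    exact (hχ.mul (contDiff_cnv hI h0 (contDiff_poisson hs)).continuous).aestronglyMeasurable
  · filter_upwards [self_mem_nhdsWithin] with s hs
    refine Filter.Eventually.of_forall fun x => ?_
    rw [norm_mul]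
    exact (mul_le_of_le_one_left (norm_nonneg _) (hχ1 x)).trans (abs_cnv_poisson_le hs hb x)
  · have : ∀ᵐ x ∂σ, x ∉ F := by
      rw [ae_iff]; simpa using hσF
    filter_upwards [this] with x hx
    obtain ⟨r, hr, hrF⟩ := Metric.isOpen_iff.1 hF.isOpen_compl x hx
    have hlim : Filter.Tendsto (fun s : ℝ => d * s ^ 2 * (r ^ (d + 2))⁻¹ *
        volume.real (closedBall (0 : Euc d) 1)) (nhdsWithin 0 (Set.Ioi 0)) (nhds 0) := by
      have : Continuous (fun s : ℝ => d * s ^ 2 * (r ^ (d + 2))⁻¹ *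
        volume.real (closedBall (0 : Euc d) 1)) := by fun_prop
      simpa using (this.tendsto 0).mono_left nhdsWithin_le_nhds
    refine squeeze_zero_norm' ?_ hlim
    filter_upwards [self_mem_nhdsWithin] with s hs
    rw [norm_mul]
    exact (mul_le_of_le_one_left (norm_nonneg _) (hχ1 x)).trans
      (abs_cnv_poisson_le_of_ball hs h0 hb hr fun y hy => hF0 y (hrF hy))

lemma integral_norm_cnv_rieszD_le {G : Type*} [NormedAddCommGroup G]
    {Φ : Euc d → G} (hΦ : UniformContinuous Φ) {F : Set (Euc d)} (hF : IsClosed F)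
    (hFne : F.Nonempty) {A : ℝ} (hA : 1 ≤ A)
    (hosc : ∀ x x', dist x x' < infDist x F / 4 → ‖Φ x - Φ x'‖ ≤ A)
    {τ : Measure (Euc d)} [IsFiniteMeasure τ] {l B κ : ℝ} (hl : 0 < l) (hB : 0 < B) (hκ : 0 < κ)
    (hτ : ∀ x ∈ F, ∀ r : ℝ, 0 < r → τ (ball x r) ≤ ENNReal.ofReal (l * r ^ d))
    (hL2 : ∫⁻ y, ENNReal.ofReal (‖Φ y‖ ^ 2) ≤ ENNReal.ofReal B) :
    Integrable (fun x => ‖Φ x‖) τ ∧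
    ∫ x, ‖Φ x‖ ∂τ ≤ 1 / (4 * κ) * τ.real Set.univ + κ * (2 * A ^ 2 * τ.real Set.univ +
      2 * (l * 12 ^ d / volume.real (ball (0 : Euc d) 1) * B)) := by
  set v := volume.real (ball (0 : Euc d) 1) with hv
  have hv0 : 0 < v :=
    ENNReal.toReal_pos (measure_ball_pos _ _ one_pos).ne' measure_ball_lt_top.ne
  have h1 := lintegral_norm_sq_le hΦ hF hFne hA hosc hτ
  have h2 := lintegral_norm_le_add (Φ := Φ) τ hκ
  have h3 : ∫⁻ x, ENNReal.ofReal ‖Φ x‖ ∂τ ≤ ENNReal.ofReal (1 / (4 * κ) * τ.real Set.univ +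
      κ * (2 * A ^ 2 * τ.real Set.univ + 2 * (l * 12 ^ d / v * B))) := by
    refine h2.trans ?_
    rw [ENNReal.ofReal_add (by positivity) (by positivity), ENNReal.ofReal_mul (by positivity),
      ENNReal.ofReal_mul hκ.le, ENNReal.ofReal_add (by positivity) (by positivity),
      ENNReal.ofReal_mul (p := 2 * A ^ 2) (by positivity),
      ENNReal.ofReal_mul (p := 2) (q := l * 12 ^ d / v * B) (by positivity),
      ENNReal.ofReal_mul (q := B) (by positivity), ofReal_measureReal, ENNReal.ofReal_ofNat]
    gcongr
    exact h1.trans (by gcongr)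
  have hm : AEStronglyMeasurable (fun x => ‖Φ x‖) τ := hΦ.continuous.norm.aestronglyMeasurable
  have hn : 0 ≤ᵐ[τ] fun x => ‖Φ x‖ := Filter.Eventually.of_forall fun x => norm_nonneg _
  refine ⟨(lintegral_ofReal_ne_top_iff_integrable hm hn).1 (h3.trans_lt ENNReal.ofReal_lt_top).ne, ?_⟩
  rw [integral_eq_lintegral_of_nonneg_ae hn hm]
  exact ENNReal.toReal_le_of_le_ofReal (by positivity) h3

end smallness

section core

variable {d : ℕ} {s : ℝ}

lemma sum_apply_single_mul (L : Euc d →L[ℝ] ℝ) (w : Euc d) :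
    ∑ i, L (EuclideanSpace.single i 1) * w i = L w := by
  conv_rhs => rw [← (EuclideanSpace.basisFun (Fin d) ℝ).sum_repr w]
  simp [mul_comm]

lemma cnv_indicator_add {G : Type*} [NormedAddCommGroup G] [NormedSpace ℝ G] {ψ : Euc d → ℝ}
    (hI : Integrable ψ) (h0 : ∀ y, y ∉ closedBall (0 : Euc d) 1 → ψ y = 0) {F : Set (Euc d)}
    (hF : MeasurableSet F) {K : Euc d → G} (hK : Continuous K) (x : Euc d) :
    cnv (Fᶜ.indicator ψ) K x = cnv ψ K x - cnv (F.indicator ψ) K x := by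
  have h1 : ∀ S : Set (Euc d), ∀ y, y ∉ closedBall (0 : Euc d) 1 → S.indicator ψ y = 0 := by
    intro S y hy
    rw [Set.indicator_apply_eq_zero]
    exact fun _ => h0 y hy
  unfold cnv
  rw [← integral_sub (integrable_cnv hI h0 hK x) (integrable_cnv (hI.indicator hF) (h1 F) hK x)]
  refine integral_congr_ae (Filter.Eventually.of_forall fun y => ?_)
  by_cases hy : y ∈ F
  · simp only [Set.indicator_of_mem hy, Set.indicator_of_notMem (Set.notMem_compl_iff.2 hy), sub_self]
    rw [zero_smul]
  · have : y ∈ Fᶜ := hy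
    simp only [Set.indicator_of_notMem hy, Set.indicator_of_mem this]
    rw [zero_smul, sub_zero]

/-- The localised Riesz potential used as a test field. -/
noncomputable def testField (χ k : Euc d → ℝ) (s : ℝ) (x : Euc d) : Euc d :=
  χ x • cnv k (riesz s) x

section testField
variable {χ k : Euc d → ℝ}

lemma contDiff_testField (hχ : ContDiff ℝ (⊤ : ℕ∞) χ) (hs : 0 < s) (hI : Integrable k)
    (h0 : ∀ y, y ∉ closedBall (0 : Euc d) 1 → k y = 0) :
    ContDiff ℝ (⊤ : ℕ∞) (testField χ k s) :=
  hχ.smul (contDiff_cnv hI h0 (contDiff_riesz hs))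

lemma fderiv_testField (hχ : ContDiff ℝ (⊤ : ℕ∞) χ) (hs : 0 < s) (hI : Integrable k)
    (h0 : ∀ y, y ∉ closedBall (0 : Euc d) 1 → k y = 0) (x : Euc d) :
    fderiv ℝ (testField χ k s) x =
    χ x • cnv k (rieszD s) x + (fderiv ℝ χ x).smulRight (cnv k (riesz s) x) :=
  ((hχ.differentiable (by simp) x).hasFDerivAt.smul (hasFDerivAt_cnv_riesz hs hI h0 x)).fderiv

lemma diverg_testField (hχ : ContDiff ℝ (⊤ : ℕ∞) χ) (hs : 0 < s) (hI : Integrable k)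
    (h0 : ∀ y, y ∉ closedBall (0 : Euc d) 1 → k y = 0) (x : Euc d) :
    diverg (testField χ k s) x =
    χ x * cnv k (poisson s) x + fderiv ℝ χ x (cnv k (riesz s) x) := by
  rw [diverg, fderiv_testField hχ hs hI h0, ← sum_cnv_rieszD hs hI h0, Finset.mul_sum,
    ← sum_apply_single_mul (fderiv ℝ χ x), ← Finset.sum_add_distrib]
  refine Finset.sum_congr rfl fun i _ => ?_
  simp

end testField

/-- A purely singular measure which is not too small near the origin has, up to a definite amount,
a divergence that is not controlled by first derivatives of test fields in a small measure. -/
theorem exists_testField (hd : 0 < d) {C₀ : ℝ} (hC₀ : 0 ≤ C₀) : ∃ ε : ℝ, 0 < ε ∧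
    ∀ (σ τ : Measure (Euc d)) [IsFiniteMeasure σ] [IsFiniteMeasure τ],
      σ.MutuallySingular volume → σ.real Set.univ ≤ C₀ → 1 ≤ σ.real (closedBall 0 (1 / 4)) →
      τ.real Set.univ ≤ ε →
      ∃ θ : Euc d → Euc d, ContDiff ℝ (⊤ : ℕ∞) θ ∧ tsupport θ ⊆ ball 0 1 ∧
        ∫ x, (‖fderiv ℝ θ x‖ + ‖θ x‖) ∂τ < |∫ x, diverg θ x ∂σ| := by
  have : Nonempty (Fin d) := ⟨⟨0, hd⟩⟩
  let ψ : ContDiffBump (0 : Euc d) := ⟨1 / 2, 1, by norm_num, by norm_num⟩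
  let χ : ContDiffBump (0 : Euc d) := ⟨1 / 4, 1 / 2, by norm_num, by norm_num⟩
  have hψt : tsupport ψ ⊆ closedBall (0 : Euc d) 1 := ψ.tsupport_eq.subset
  have hψ0 : ∀ y, y ∉ closedBall (0 : Euc d) 1 → ψ y = 0 := fun y hy =>
    image_eq_zero_of_notMem_tsupport fun h => hy (hψt h)
  have hψI : Integrable ψ := ψ.continuous.integrable_of_hasCompactSupport ψ.hasCompactSupport
  obtain ⟨A, hA, hosc⟩ := exists_osc_cnv_rieszD d
  obtain ⟨B, hB, hL2⟩ := exists_integral_cnv_rieszD_sq_le hd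
  obtain ⟨Mψ, hMψ, hMψb⟩ := exists_norm_cnv_rieszD_le hd ψ.contDiff hψt
  obtain ⟨M, hM⟩ := (χ.hasCompactSupport.fderiv ℝ).exists_bound_of_continuous
    (χ.contDiff.continuous_fderiv (n := (⊤ : ℕ∞)) (by simp))
  have hM0 : 0 ≤ M := (norm_nonneg _).trans (hM 0)
  set v := volume.real (ball (0 : Euc d) 1) with hv
  have hv0 : 0 < v :=
    ENNReal.toReal_pos (measure_ball_pos _ _ one_pos).ne' measure_ball_lt_top.ne
  have hdR : (0 : ℝ) < d := by exact_mod_cast hd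
  set c : ℝ := d * (2 ^ (d + 2))⁻¹ * v with hc
  have hc0 : 0 < c := by positivity
  set η : ℝ := min 1 (c / (8 * ((M + 1) * (C₀ + 1)))) with hη
  have hη0 : 0 < η := by positivity
  have hη1 : η ≤ 1 := min_le_left _ _
  have hη2 : M * η * C₀ ≤ c / 8 := by
    calc M * η * C₀ ≤ (M + 1) * (c / (8 * ((M + 1) * (C₀ + 1)))) * (C₀ + 1) := by
          gcongr
          · linarith
          · exact min_le_right _ _
          · linarith
      _ = c / 8 := by field_simp
  obtain ⟨q, hq, hqb⟩ := exists_lintegral_riesz_sub_le hd hη0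
  set l : ℝ := 5 ^ d * v * (C₀ + 1) / q with hl
  have hl0 : 0 < l := by positivity
  set A' := max 1 A with hA'
  set κ : ℝ := c / (8 * (2 * (l * 12 ^ d / v * B))) with hκ
  have hκ0 : 0 < κ := by positivity
  have hκ1 : κ * (2 * (l * 12 ^ d / v * B)) = c / 8 := by rw [hκ]; field_simp
  set M₀ : ℝ := Mψ + M * η + η with hM₀
  set D : ℝ := M₀ + 1 / (4 * κ) + κ * (2 * A' ^ 2) with hD
  have hD0 : 0 < D := by positivity
  refine ⟨min 1 (c / (8 * D)), by positivity, fun σ τ _ _ hσ hσ1 hσ2 hτ => ?_⟩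
  have hτ1 : τ.real Set.univ ≤ 1 := hτ.trans (min_le_left _ _)
  have hτ2 : D * τ.real Set.univ ≤ c / 8 := by
    calc D * τ.real Set.univ ≤ D * (c / (8 * D)) := by gcongr; exact hτ.trans (min_le_right _ _)
      _ = c / 8 := by field_simp
  set ω := σ + τ with hω
  have hσω : σ ≤ ω := Measure.le_add_right le_rfl
  have hτω : τ ≤ ω := Measure.le_add_left le_rfl
  set F := lowDensity ω l with hF
  have hFc : IsClosed F := isClosed_lowDensity ω l
  have hFm := hFc.measurableSet
  have hFvol : volume Fᶜ ≤ ENNReal.ofReal q := by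
    have h1 := volume_compl_lowDensity_le hd ω hl0
    have h2 : ω Set.univ ≤ ENNReal.ofReal (C₀ + 1) := by
      rw [hω, Measure.add_apply, ENNReal.ofReal_add hC₀ zero_le_one, ← ofReal_measureReal (μ := σ),
        ← ofReal_measureReal (μ := τ)]
      gcongr
    have h3 : ENNReal.ofReal l * volume Fᶜ ≤ ENNReal.ofReal l * ENNReal.ofReal q := by
      refine h1.trans ((mul_le_mul_right h2 _).trans (le_of_eq ?_))
      rw [← ENNReal.ofReal_mul (by positivity), ← ENNReal.ofReal_mul (by positivity), hl]
      congr 1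
      field_simp
      rw [hv]
    exact (ENNReal.mul_le_mul_iff_right (ENNReal.ofReal_pos.2 hl0).ne' ENNReal.ofReal_ne_top).1 h3
  have hFne : F.Nonempty := by
    by_contra h
    rw [Set.not_nonempty_iff_eq_empty] at h
    rw [h, Set.compl_empty, measure_univ_of_isAddLeftInvariant] at hFvol
    exact ENNReal.ofReal_ne_top (top_le_iff.1 hFvol)
  have hσF : σ F = 0 := measure_lowDensity_eq_zero hσω hσ hl0
  set h : Euc d → ℝ := F.indicator ψ with hh
  set k : Euc d → ℝ := Fᶜ.indicator ψ with hk
  have hind : ∀ (S : Set (Euc d)) (y : Euc d), y ∉ closedBall (0 : Euc d) 1 → S.indicator ψ y = 0 :=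
    fun S y hy => Set.indicator_apply_eq_zero.2 fun _ => hψ0 y hy
  have hind1 : ∀ (S : Set (Euc d)) (y : Euc d), |S.indicator ψ y| ≤ 1 := by
    intro S y
    by_cases hy : y ∈ S
    · rw [Set.indicator_of_mem hy, abs_of_nonneg ψ.nonneg]; exact ψ.le_one
    · rw [Set.indicator_of_notMem hy]; simp
  have hhI : Integrable h := hψI.indicator hFm
  have hkI : Integrable k := hψI.indicator hFm.compl
  have hhF : ∀ y, y ∉ F → h y = 0 := fun y hy => Set.indicator_of_notMem hy _
  have hχ1 : ∀ x, |χ x| ≤ 1 := fun x => by rw [abs_of_nonneg χ.nonneg]; exact χ.le_one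
  obtain ⟨s, hs⟩ : ∃ s : ℝ, 0 < s ∧ s < 1 / 4 ∧ |∫ x, χ x * cnv h (poisson s) x ∂σ| < c / 8 := by
    have hlim := tendsto_integral_mul_cnv_poisson hFc hσF χ.continuous hχ1 hhI (hind F) (hind1 F) hhF
    have h1 := hlim (Metric.ball_mem_nhds 0 (show 0 < c / 8 by positivity))
    have h2 : ∀ᶠ s : ℝ in nhdsWithin 0 (Set.Ioi 0), s < 1 / 4 :=
      nhdsWithin_le_nhds (Iio_mem_nhds (by norm_num))
    obtain ⟨s, hs⟩ := (h2.and (Filter.eventually_and.2 ⟨h1, self_mem_nhdsWithin⟩)).exists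
    exact ⟨s, hs.2.2, hs.1, by simpa using hs.2.1⟩
  obtain ⟨hs0, hs4, hsc⟩ := hs
  have hχc : ContDiff ℝ (⊤ : ℕ∞) χ := χ.contDiff
  -- the potential is uniformly small
  have hpot : ∀ x, ‖cnv k (riesz s) x‖ ≤ η := by
    intro x
    have h1 := (enorm_cnv_le (K := riesz s) hFm.compl (hind1 Fᶜ)
      (fun y hy => Set.indicator_of_notMem hy _) (norm_riesz_le s hd) x).trans
      (hqb x Fᶜ hFm.compl hFvol)
    rw [← ofReal_norm] at h1
    exact (ENNReal.ofReal_le_ofReal_iff hη0.le).1 h1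
  have hDχ : ∀ x, |fderiv ℝ χ x (cnv k (riesz s) x)| ≤ M * η := fun x =>
    ((fderiv ℝ χ x).le_opNorm _).trans (mul_le_mul (hM x) (hpot x) (norm_nonneg _) hM0)
  have hΦu := uniformContinuous_cnv_rieszD hd hs0 hhI (hind F)
  obtain ⟨hΦI, hΦb⟩ := integral_norm_cnv_rieszD_le hΦu hFc hFne (le_max_left 1 A)
    (fun x x' hxx => (hosc s hs0 F h hhI (hind F) (hind1 F) hhF x x' hxx).trans (le_max_right 1 A))
    hl0 hB hκ0 (fun x hx r hr => (hτω _).trans (hx r hr)) (hL2 s hs0 h hhI (hind F) (hind1 F))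
  refine ⟨testField χ k s, contDiff_testField hχc hs0 hkI (hind _), ?_, ?_⟩
  · refine (tsupport_smul_subset_left χ _).trans ?_
    rw [χ.tsupport_eq]
    exact closedBall_subset_ball (by norm_num)
  -- the bound from above
  have hupper : ∫ x, (‖fderiv ℝ (testField χ k s) x‖ + ‖testField χ k s x‖) ∂τ ≤ c / 8 + c / 8 := by
    calc ∫ x, (‖fderiv ℝ (testField χ k s) x‖ + ‖testField χ k s x‖) ∂τ
        ≤ ∫ x, (M₀ + ‖cnv h (rieszD s) x‖) ∂τ := by
          refine integral_mono_of_nonneg (Filter.Eventually.of_forall fun x => by positivity)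
            ((integrable_const _).add hΦI) (Filter.Eventually.of_forall fun x => ?_)
          have h1 : ‖fderiv ℝ (testField χ k s) x‖ ≤ (Mψ + ‖cnv h (rieszD s) x‖) + M * η := by
            rw [fderiv_testField hχc hs0 hkI (hind _)]
            refine (norm_add_le _ _).trans (add_le_add ?_ ?_)
            · rw [norm_smul, Real.norm_eq_abs]
              refine (mul_le_of_le_one_left (norm_nonneg _) (hχ1 x)).trans ?_
              rw [hk, cnv_indicator_add hψI hψ0 hFm (contDiff_rieszD hs0).continuous]
              exact (norm_sub_le _ _).trans (add_le_add (hMψb s hs0 x) le_rfl)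
            · rw [ContinuousLinearMap.norm_smulRight_apply]
              exact mul_le_mul (hM x) (hpot x) (norm_nonneg _) hM0
          have h2 : ‖testField χ k s x‖ ≤ η := by
            rw [testField, norm_smul, Real.norm_eq_abs]
            exact (mul_le_of_le_one_left (norm_nonneg _) (hχ1 x)).trans (hpot x)
          simp only
          rw [hM₀]
          linarith
      _ = M₀ * τ.real Set.univ + ∫ x, ‖cnv h (rieszD s) x‖ ∂τ := by
          rw [integral_add (integrable_const _) hΦI, integral_const, smul_eq_mul, mul_comm]
      _ ≤ D * τ.real Set.univ + κ * (2 * (l * 12 ^ d / v * B)) := by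
          rw [hD]
          linarith
      _ ≤ _ := by linarith
  -- the bound from below
  have hcψ : Continuous (cnv ψ (poisson s)) := (contDiff_cnv hψI hψ0 (contDiff_poisson hs0)).continuous
  have hch : Continuous (cnv h (poisson s)) :=
    (contDiff_cnv hhI (hind F) (contDiff_poisson hs0)).continuous
  have hck : Continuous (cnv k (riesz s)) :=
    (contDiff_cnv hkI (hind Fᶜ) (contDiff_riesz hs0)).continuous
  have hcχ : Continuous (fderiv ℝ χ) := hχc.continuous_fderiv (by simp)
  have hcs := χ.hasCompactSupport
  have i1 : Integrable (fun x => χ x * cnv ψ (poisson s) x) σ :=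
    (χ.continuous.mul hcψ).integrable_of_hasCompactSupport hcs.mul_right
  have i2 : Integrable (fun x => χ x * cnv h (poisson s) x) σ :=
    (χ.continuous.mul hch).integrable_of_hasCompactSupport hcs.mul_right
  have i3 : Integrable (fun x => fderiv ℝ χ x (cnv k (riesz s) x)) σ :=
    Integrable.mono' (integrable_const (M * η)) (hcχ.clm_apply hck).aestronglyMeasurable
      (Filter.Eventually.of_forall hDχ)
  have e : ∫ x, diverg (testField χ k s) x ∂σ = ∫ x, χ x * cnv ψ (poisson s) x ∂σ -
      ∫ x, χ x * cnv h (poisson s) x ∂σ + ∫ x, fderiv ℝ χ x (cnv k (riesz s) x) ∂σ := by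
    have i12 : Integrable (fun x => χ x * cnv ψ (poisson s) x - χ x * cnv h (poisson s) x) σ :=
      i1.sub i2
    rw [← integral_sub i1 i2, ← integral_add i12 i3]
    refine integral_congr_ae (Filter.Eventually.of_forall fun x => ?_)
    simp only
    rw [diverg_testField hχc hs0 hkI (hind _), hk,
      cnv_indicator_add hψI hψ0 hFm (continuous_poisson hs0)]
    ring
  have hlow : c ≤ ∫ x, χ x * cnv ψ (poisson s) x ∂σ := by
    have hpos : ∀ x, 0 ≤ cnv ψ (poisson s) x := fun x =>
      integral_nonneg fun y => mul_nonneg ψ.nonneg (poisson_nonneg s _)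
    calc c ≤ σ.real (closedBall 0 (1 / 4)) * c := le_mul_of_one_le_left hc0.le hσ2
      _ = ∫ x, (closedBall (0 : Euc d) (1 / 4)).indicator (fun _ => c) x ∂σ := by
          rw [integral_indicator measurableSet_closedBall, setIntegral_const, smul_eq_mul]
      _ ≤ _ := by
          refine integral_mono ((integrable_const c).indicator measurableSet_closedBall) i1
            fun x => ?_
          by_cases hx : x ∈ closedBall (0 : Euc d) (1 / 4)
          · rw [Set.indicator_of_mem hx]
            simp only
            rw [χ.one_of_mem_closedBall hx, one_mul]
            exact le_cnv_poisson hs0 hs4.le hψI hψ0 (fun _ => ψ.nonneg)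
              (fun y hy => ψ.one_of_mem_closedBall hy) hx
          · rw [Set.indicator_of_notMem hx]
            exact mul_nonneg χ.nonneg (hpos x)
  have herr : |∫ x, fderiv ℝ χ x (cnv k (riesz s) x) ∂σ| ≤ c / 8 := by
    refine le_trans ?_ hη2
    refine (norm_integral_le_of_norm_le_const
      (f := fun x => fderiv ℝ χ x (cnv k (riesz s) x)) (C := M * η)
      (Filter.Eventually.of_forall fun x => by rw [Real.norm_eq_abs]; exact hDχ x)).trans ?_
    gcongr
  have h1 := (abs_le.1 herr).1
  have h2 := (abs_lt.1 hsc).2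
  refine lt_of_le_of_lt hupper (lt_of_lt_of_le ?_ (le_abs_self _))
  rw [e]
  linarith

end core

section rescale
variable {d : ℕ} {r : ℝ} {x₀ : Euc d} {θ : Euc d → Euc d}

/-- The change of variables mapping the ball of radius `r` about `x₀` to the unit ball. -/
noncomputable def zoom (x₀ : Euc d) (r : ℝ) (x : Euc d) : Euc d := r⁻¹ • (x - x₀)

lemma continuous_zoom (x₀ : Euc d) (r : ℝ) : Continuous (zoom x₀ r) := by unfold zoom; fun_prop

lemma zoom_notMem_ball (hr : 0 < r) {x : Euc d} (hx : x ∉ closedBall x₀ r) :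
    zoom x₀ r x ∉ ball 0 1 := by
  rw [mem_closedBall, not_le, dist_eq_norm] at hx
  rw [zoom, mem_ball_zero_iff, not_lt, norm_smul, norm_inv, Real.norm_of_nonneg hr.le,
    ← div_eq_inv_mul, le_div_iff₀ hr]
  linarith

/-- The scalar test functions built from a rescaled test field. -/
noncomputable def zoomTest (Q : Fin d → Fin d → ℝ) (x₀ : Euc d) (r : ℝ)
    (θ : Euc d → Euc d) (k : Fin d) (x : Euc d) : ℝ := r * ∑ i, Q i k * θ (zoom x₀ r x) i

variable (Q : Fin d → Fin d → ℝ)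

lemma contDiff_zoomTest (hθ : ContDiff ℝ (⊤ : ℕ∞) θ) (k : Fin d) :
    ContDiff ℝ (⊤ : ℕ∞) (zoomTest Q x₀ r θ k) := by
  unfold zoomTest zoom
  refine contDiff_const.mul (ContDiff.sum fun i _ => contDiff_const.mul ?_)
  have h : ContDiff ℝ (⊤ : ℕ∞) fun x => θ (r⁻¹ • (x - x₀)) :=
    hθ.comp (by fun_prop)
  exact (contDiff_euclidean.1 h) i

lemma zoomTest_eq_zero (hr : 0 < r) (hθ : tsupport θ ⊆ ball 0 1) (k : Fin d) {x : Euc d}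
    (hx : x ∉ closedBall x₀ r) : zoomTest Q x₀ r θ k x = 0 := by
  have : θ (zoom x₀ r x) = 0 :=
    image_eq_zero_of_notMem_tsupport fun h => zoom_notMem_ball hr hx (hθ h)
  simp [zoomTest, this]

lemma tsupport_zoomTest_subset (hr : 0 < r) (hθ : tsupport θ ⊆ ball 0 1) (k : Fin d) :
    tsupport (zoomTest Q x₀ r θ k) ⊆ closedBall x₀ r :=
  closure_minimal (fun x hx => by
    by_contra h
    exact hx (zoomTest_eq_zero Q hr hθ k h)) isClosed_closedBall

lemma hasCompactSupport_zoomTest (hr : 0 < r) (hθ : tsupport θ ⊆ ball 0 1) (k : Fin d) :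
    HasCompactSupport (zoomTest Q x₀ r θ k) :=
  HasCompactSupport.intro (isCompact_closedBall x₀ r) fun _ hx => zoomTest_eq_zero Q hr hθ k hx

lemma pderiv'_zoomTest (hr : 0 < r) (hθ : ContDiff ℝ (⊤ : ℕ∞) θ) (k j : Fin d) (x : Euc d) :
    pderiv' j (zoomTest Q x₀ r θ k) x =
      ∑ i, Q i k * fderiv ℝ θ (zoom x₀ r x) (EuclideanSpace.single j 1) i := by
  let L : Euc d →L[ℝ] ℝ := r • ∑ i, Q i k • EuclideanSpace.proj i
  have hS : HasFDerivAt (zoom x₀ r) (r⁻¹ • ContinuousLinearMap.id ℝ (Euc d)) x :=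
    ((hasFDerivAt_id x).sub_const x₀).const_smul r⁻¹
  have h1 := (hθ.differentiable (by simp) (zoom x₀ r x)).hasFDerivAt.comp x hS
  have h2 := L.hasFDerivAt.comp x h1
  have h3 : zoomTest Q x₀ r θ k = L ∘ (θ ∘ zoom x₀ r) := by
    ext y
    simp [zoomTest, L]
  rw [pderiv', h3, h2.fderiv]
  simp only [ContinuousLinearMap.comp_apply, _root_.smul_apply, L,
    ContinuousLinearMap.id_apply, map_smul, _root_.sum_apply, smul_eq_mul, PiLp.proj_apply]
  rw [← mul_assoc, inv_mul_cancel₀ hr.ne', one_mul]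

lemma sum_pderiv'_zoomTest (hr : 0 < r) (hθ : ContDiff ℝ (⊤ : ℕ∞) θ)
    {P : Fin d → Fin d → ℝ} (hQ : ∀ i j, ∑ k, Q i k * P k j = if i = j then 1 else 0) (x : Euc d) :
    ∑ k, ∑ j, pderiv' j (zoomTest Q x₀ r θ k) x * P k j = diverg θ (zoom x₀ r x) := by
  simp only [pderiv'_zoomTest Q hr hθ, diverg, Finset.sum_mul]
  rw [Finset.sum_comm]
  refine Finset.sum_congr rfl fun j _ => ?_
  rw [Finset.sum_comm]
  calc _ = ∑ i, (∑ k, Q i k * P k j) *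
        fderiv ℝ θ (zoom x₀ r x) (EuclideanSpace.single j 1) i := by
        refine Finset.sum_congr rfl fun i _ => ?_
        rw [Finset.sum_mul]
        exact Finset.sum_congr rfl fun k _ => by ring
    _ = _ := by simp [hQ]

/-- The sum of the absolute values of the entries of a matrix. -/
noncomputable def absSum (Q : Fin d → Fin d → ℝ) : ℝ := ∑ i, ∑ k, |Q i k|

lemma absSum_nonneg : 0 ≤ absSum Q := by unfold absSum; positivity

lemma abs_sum_mul_le_absSum (k : Fin d) (w : Euc d) : |∑ i, Q i k * w i| ≤ absSum Q * ‖w‖ := by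
  refine (Finset.abs_sum_le_sum_abs _ _).trans ?_
  rw [absSum, Finset.sum_mul]
  refine Finset.sum_le_sum fun i _ => ?_
  rw [abs_mul]
  exact mul_le_mul (Finset.single_le_sum (f := fun k => |Q i k|) (fun _ _ => abs_nonneg _)
    (Finset.mem_univ k)) (abs_coord_le w i) (abs_nonneg _) (by positivity)

lemma abs_pderiv'_zoomTest_le (hr : 0 < r) (hθ : ContDiff ℝ (⊤ : ℕ∞) θ) (k j : Fin d) (x : Euc d) :
    |pderiv' j (zoomTest Q x₀ r θ k) x| ≤
      absSum Q * (‖fderiv ℝ θ (zoom x₀ r x)‖ + ‖θ (zoom x₀ r x)‖) := by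
  rw [pderiv'_zoomTest Q hr hθ]
  refine (abs_sum_mul_le_absSum Q k _).trans (mul_le_mul_of_nonneg_left ?_ (absSum_nonneg Q))
  have := (fderiv ℝ θ (zoom x₀ r x)).le_opNorm (EuclideanSpace.single j 1)
  rw [PiLp.norm_single, norm_one, mul_one] at this
  linarith [norm_nonneg (θ (zoom x₀ r x))]

lemma abs_zoomTest_le (hr : 0 < r) (k : Fin d) (x : Euc d) :
    |zoomTest Q x₀ r θ k x| ≤
      r * (absSum Q * (‖fderiv ℝ θ (zoom x₀ r x)‖ + ‖θ (zoom x₀ r x)‖)) := by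
  rw [zoomTest, abs_mul, abs_of_pos hr]
  refine mul_le_mul_of_nonneg_left ((abs_sum_mul_le_absSum Q k _).trans ?_) hr.le
  exact mul_le_mul_of_nonneg_left (by linarith [norm_nonneg (fderiv ℝ θ (zoom x₀ r x))])
    (absSum_nonneg Q)

end rescale

section estimate
variable {d : ℕ} {r : ℝ} {x₀ : Euc d} {θ : Euc d → Euc d}

/-- The pointwise first order size of a test field at the rescaled point. -/
noncomputable def zoomSize (x₀ : Euc d) (r : ℝ) (θ : Euc d → Euc d) (x : Euc d) : ℝ :=
  ‖fderiv ℝ θ (zoom x₀ r x)‖ + ‖θ (zoom x₀ r x)‖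

lemma zoomSize_nonneg (x : Euc d) : 0 ≤ zoomSize x₀ r θ x := by unfold zoomSize; positivity

lemma continuous_zoomSize (hθ : ContDiff ℝ (⊤ : ℕ∞) θ) : Continuous (zoomSize x₀ r θ) :=
  ((hθ.continuous_fderiv (by simp)).comp (continuous_zoom x₀ r)).norm.add
    (hθ.continuous.comp (continuous_zoom x₀ r)).norm

lemma hasCompactSupport_of_tsupport_subset_ball (hθ : tsupport θ ⊆ ball 0 1) :
    HasCompactSupport θ :=
  (isCompact_closedBall (0 : Euc d) 1).of_isClosed_subset (isClosed_tsupport θ)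
    (hθ.trans ball_subset_closedBall)

lemma exists_zoomSize_le (hθ : ContDiff ℝ (⊤ : ℕ∞) θ) (hs : tsupport θ ⊆ ball 0 1) :
    ∃ K, ∀ x, zoomSize x₀ r θ x ≤ K := by
  have hc := hasCompactSupport_of_tsupport_subset_ball hs
  obtain ⟨A, hA⟩ := hc.exists_bound_of_continuous hθ.continuous
  obtain ⟨B, hB⟩ := (hc.fderiv ℝ).exists_bound_of_continuous (hθ.continuous_fderiv (by simp))
  exact ⟨B + A, fun x => add_le_add (hB _) (hA _)⟩

lemma integrable_zoomSize (hθ : ContDiff ℝ (⊤ : ℕ∞) θ) (hs : tsupport θ ⊆ ball 0 1)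
    (α : Measure (Euc d)) [IsFiniteMeasure α] : Integrable (zoomSize x₀ r θ) α := by
  obtain ⟨K, hK⟩ := exists_zoomSize_le (x₀ := x₀) (r := r) hθ hs
  exact Integrable.mono' (integrable_const K) (continuous_zoomSize hθ).aestronglyMeasurable
    (Filter.Eventually.of_forall fun x => by
      rw [Real.norm_of_nonneg (zoomSize_nonneg x)]; exact hK x)

/-- The entrywise distance between a matrix field and a constant matrix. -/
noncomputable def entryDist (f : Euc d → Fin d → Fin d → ℝ) (P : Fin d → Fin d → ℝ)
    (x : Euc d) : ENNReal := ∑ k, ∑ j, ‖f x k j - P k j‖ₑ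

lemma toReal_entryDist (f : Euc d → Fin d → Fin d → ℝ) (P : Fin d → Fin d → ℝ)
    (x : Euc d) : (entryDist f P x).toReal = ∑ k, ∑ j, |f x k j - P k j| := by
  rw [entryDist, ENNReal.toReal_sum fun _ _ => ENNReal.sum_ne_top.2 fun _ _ => enorm_ne_top]
  refine Finset.sum_congr rfl fun k _ => ?_
  rw [ENNReal.toReal_sum fun j _ => enorm_ne_top]
  exact Finset.sum_congr rfl fun j _ => by rw [toReal_enorm, Real.norm_eq_abs]

lemma entryDist_lt_top (f : Euc d → Fin d → Fin d → ℝ) (P : Fin d → Fin d → ℝ)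
    (x : Euc d) : entryDist f P x < ⊤ :=
  ENNReal.sum_lt_top.2 fun _ _ => ENNReal.sum_lt_top.2 fun _ _ => enorm_lt_top

/-- The measure controlling the error made by freezing the density `f` at `P` on the measure `σ`,
neglecting the part `α` and the divergence `τ`, at the scale `r`. -/
noncomputable def errorMeasure (σ α τ : Measure (Euc d)) (f : Euc d → Fin d → Fin d → ℝ)
    (P : Fin d → Fin d → ℝ) (r : ℝ) : Measure (Euc d) :=
  α + σ.withDensity (entryDist f P) + ENNReal.ofReal r • τ

lemma aemeasurable_entryDist {σ : Measure (Euc d)} {f : Euc d → Fin d → Fin d → ℝ}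
    {P : Fin d → Fin d → ℝ}
    (hfσ : ∀ k j, AEStronglyMeasurable (fun x => f x k j) σ) :
    AEMeasurable (entryDist f P) σ := by
  unfold entryDist
  refine Finset.aemeasurable_fun_sum _ fun k _ => Finset.aemeasurable_fun_sum _ fun j _ => ?_
  exact ((hfσ k j).sub aestronglyMeasurable_const).enorm

variable {σ α τ : Measure (Euc d)} [IsFiniteMeasure σ] [IsFiniteMeasure α] [IsFiniteMeasure τ]
  {f : Euc d → Fin d → Fin d → ℝ} {P Q : Fin d → Fin d → ℝ}
  {g : Euc d → Euc d}

lemma isFiniteMeasure_errorMeasure (hfσ : ∀ k j, Integrable (fun x => f x k j) σ) :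
    IsFiniteMeasure (errorMeasure σ α τ f P r) := by
  have h : IsFiniteMeasure (σ.withDensity (entryDist f P)) := by
    refine isFiniteMeasure_withDensity ?_
    unfold entryDist
    have m : ∀ k j, AEMeasurable (fun x => ‖f x k j - P k j‖ₑ) σ := fun k j =>
      ((hfσ k j).1.sub aestronglyMeasurable_const).enorm
    rw [lintegral_finsetSum' _ fun k _ => Finset.aemeasurable_fun_sum _ fun j _ => m k j]
    refine ENNReal.sum_ne_top.2 fun k _ => ?_
    rw [lintegral_finsetSum' _ fun j _ => m k j]
    exact ENNReal.sum_ne_top.2 fun j _ => ((hfσ k j).sub (integrable_const _)).2.ne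
  have h2 : IsFiniteMeasure (ENNReal.ofReal r • τ) := τ.smul_finite ENNReal.ofReal_ne_top
  unfold errorMeasure
  infer_instance

lemma integral_errorMeasure (hr : 0 < r) (hfσ : ∀ k j, Integrable (fun x => f x k j) σ)
    {N : Euc d → ℝ} (hN : Continuous N) (h0 : ∀ x, 0 ≤ N x) {K : ℝ} (hK : ∀ x, N x ≤ K) :
    ∫ x, N x ∂(errorMeasure σ α τ f P r) = ∫ x, N x ∂α +
      ∑ k, ∑ j, ∫ x, N x * |f x k j - P k j| ∂σ + r * ∫ x, N x ∂τ := by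
  have hfin := isFiniteMeasure_errorMeasure (σ := σ) (α := α) (τ := τ) (P := P) (r := r) hfσ
  have hInt : Integrable N (errorMeasure σ α τ f P r) :=
    Integrable.mono' (integrable_const K) hN.aestronglyMeasurable
      (Filter.Eventually.of_forall fun x => by rw [Real.norm_of_nonneg (h0 x)]; exact hK x)
  unfold errorMeasure at hInt ⊢
  have h1 := hInt.left_of_add_measure
  have h2 := hInt.right_of_add_measure
  have i : ∀ k j, Integrable (fun x => N x * |f x k j - P k j|) σ := fun k j =>
    ((hfσ k j).sub (integrable_const _)).abs.bdd_mul hN.aestronglyMeasurable (c := K)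
      (Filter.Eventually.of_forall fun x => by rw [Real.norm_of_nonneg (h0 x)]; exact hK x)
  rw [integral_add_measure h1 h2, integral_add_measure h1.left_of_add_measure
    h1.right_of_add_measure, integral_smul_measure, ENNReal.toReal_ofReal hr.le, smul_eq_mul,
    integral_withDensity_eq_integral_toReal_smul₀ (aemeasurable_entryDist fun k j => (hfσ k j).1)
      (Filter.Eventually.of_forall fun x => entryDist_lt_top f P x)]
  congr 2
  simp only [toReal_entryDist, smul_eq_mul, mul_comm _ (N _), Finset.mul_sum]
  rw [integral_finsetSum _ fun k _ => integrable_finsetSum _ fun j _ => i k j]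
  exact Finset.sum_congr rfl fun k _ => integral_finsetSum _ fun j _ => i k j

theorem abs_integral_diverg_zoom_le (hr : 0 < r) (hQ : ∀ i j, ∑ k, Q i k * P k j = if i = j then 1 else 0)
    (hθ : ContDiff ℝ (⊤ : ℕ∞) θ) (hs : tsupport θ ⊆ ball 0 1)
    (hfm : ∀ k j, AEStronglyMeasurable (fun x => f x k j) (σ + α))
    (hf1 : ∀ᵐ x ∂(σ + α), ∀ k j, |f x k j| ≤ 1)
    (hg1 : ∀ᵐ x ∂τ, ‖g x‖ = 1)
    (hdiv : ∀ φ : Euc d → ℝ, ContDiff ℝ (⊤ : ℕ∞) φ → HasCompactSupport φ →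
      tsupport φ ⊆ closedBall x₀ r → ∀ k : Fin d,
        ∑ j, ∫ x, pderiv' j φ x * f x k j ∂(σ + α) = - ∫ x, φ x * g x k ∂τ) :
    |∫ x, diverg θ (zoom x₀ r x) ∂σ| ≤ absSum Q * (d + 1) ^ 2 *
      ∫ x, zoomSize x₀ r θ x ∂(errorMeasure σ α τ f P r) := by
  obtain ⟨K, hK⟩ := exists_zoomSize_le (x₀ := x₀) (r := r) hθ hs
  have hN0 := zoomSize_nonneg (x₀ := x₀) (r := r) (θ := θ)
  have hNc := continuous_zoomSize (x₀ := x₀) (r := r) hθ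
  set N := zoomSize x₀ r θ with hN
  set q := absSum Q with hq
  have hq0 : 0 ≤ q := absSum_nonneg Q
  have hfi : ∀ k j, Integrable (fun x => f x k j) (σ + α) := fun k j =>
    Integrable.mono' (integrable_const 1) (hfm k j) (hf1.mono fun x hx => hx k j)
  have hfσ := fun k j => (hfi k j).left_of_add_measure
  have hfα := fun k j => (hfi k j).right_of_add_measure
  have hα1 : ∀ᵐ x ∂α, ∀ k j, |f x k j| ≤ 1 := ae_mono (Measure.le_add_left le_rfl) hf1
  let φ := zoomTest Q x₀ r θ
  let D : Fin d → Fin d → Euc d → ℝ := fun k j => pderiv' j (φ k)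
  have hφ : ∀ k, ContDiff ℝ (⊤ : ℕ∞) (φ k) := contDiff_zoomTest Q hθ
  have hDc : ∀ k j, Continuous (D k j) := fun k j =>
    ((hφ k).continuous_fderiv (by simp)).clm_apply continuous_const
  have hDb : ∀ k j x, |D k j x| ≤ q * N x := fun k j x => abs_pderiv'_zoomTest_le Q hr hθ k j x
  have hDK : ∀ k j x, ‖D k j x‖ ≤ q * K := fun k j x =>
    (hDb k j x).trans (mul_le_mul_of_nonneg_left (hK x) hq0)
  have hNi : ∀ (m : Measure (Euc d)) [IsFiniteMeasure m], Integrable N m := fun m _ =>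
    integrable_zoomSize hθ hs m
  have iD : ∀ (m : Measure (Euc d)) (k j : Fin d) (u : Euc d → ℝ), Integrable u m →
      Integrable (fun x => D k j x * u x) m := fun m k j u hu =>
    hu.bdd_mul (c := q * K) (hDc k j).aestronglyMeasurable (Filter.Eventually.of_forall (hDK k j))
  have hsum : ∑ k, ∑ j, ∫ x, D k j x * f x k j ∂(σ + α) = - ∑ k, ∫ x, φ k x * g x k ∂τ := by
    rw [← Finset.sum_neg_distrib]
    exact Finset.sum_congr rfl fun k _ => hdiv (φ k) (hφ k) (hasCompactSupport_zoomTest Q hr hs k)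
      (tsupport_zoomTest_subset Q hr hs k) k
  have hsplit : ∀ k j, ∫ x, D k j x * f x k j ∂(σ + α) = ∫ x, D k j x * P k j ∂σ +
      ∫ x, D k j x * (f x k j - P k j) ∂σ + ∫ x, D k j x * f x k j ∂α := by
    intro k j
    rw [integral_add_measure (iD σ k j _ (hfσ k j)) (iD α k j _ (hfα k j)),
      ← integral_add (iD σ k j (fun _ => P k j) (integrable_const _))
        (iD σ k j (fun x => f x k j - P k j) ((hfσ k j).sub (integrable_const _)))]
    congr 1
    exact integral_congr_ae (Filter.Eventually.of_forall fun x => by simp only; ring)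
  have hmain : ∑ k, ∑ j, ∫ x, D k j x * P k j ∂σ = ∫ x, diverg θ (zoom x₀ r x) ∂σ := by
    have iP := fun k j => iD σ k j (fun _ => P k j) (integrable_const _)
    have h := integral_finsetSum (μ := σ) (Finset.univ : Finset (Fin d))
      (f := fun k x => ∑ j, D k j x * P k j)
      fun k _ => integrable_finsetSum _ fun j _ => iP k j
    rw [← integral_congr_ae (Filter.Eventually.of_forall fun x =>
        sum_pderiv'_zoomTest (x₀ := x₀) Q hr hθ hQ x)]
    refine Eq.trans ?_ h.symm
    exact Finset.sum_congr rfl fun k _ => (integral_finsetSum _ fun j _ => iP k j).symm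
  have b1 : ∀ k j, |∫ x, D k j x * (f x k j - P k j) ∂σ| ≤
      q * ∫ x, N x * |f x k j - P k j| ∂σ := by
    intro k j
    rw [← integral_const_mul, ← Real.norm_eq_abs]
    refine norm_integral_le_of_norm_le ?_ (Filter.Eventually.of_forall fun x => ?_)
    · refine Integrable.const_mul ?_ _
      exact ((hfσ k j).sub (integrable_const _)).abs.bdd_mul hNc.aestronglyMeasurable (c := K)
        (Filter.Eventually.of_forall fun x => by rw [Real.norm_of_nonneg (hN0 x)]; exact hK x)
    · rw [norm_mul, Real.norm_eq_abs, Real.norm_eq_abs, ← mul_assoc]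
      exact mul_le_mul_of_nonneg_right (hDb k j x) (abs_nonneg _)
  have b2 : ∀ k j, |∫ x, D k j x * f x k j ∂α| ≤ q * ∫ x, N x ∂α := by
    intro k j
    rw [← integral_const_mul, ← Real.norm_eq_abs]
    refine norm_integral_le_of_norm_le ((hNi α).const_mul q) ?_
    filter_upwards [hα1] with x hx
    rw [norm_mul, Real.norm_eq_abs, Real.norm_eq_abs]
    exact (mul_le_of_le_one_right (abs_nonneg _) (hx k j)).trans (hDb k j x)
  have b3 : ∀ k, |∫ x, φ k x * g x k ∂τ| ≤ q * (r * ∫ x, N x ∂τ) := by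
    intro k
    rw [← integral_const_mul, ← integral_const_mul, ← Real.norm_eq_abs]
    refine norm_integral_le_of_norm_le (((hNi τ).const_mul r).const_mul q) ?_
    filter_upwards [hg1] with x hx
    rw [norm_mul, Real.norm_eq_abs, Real.norm_eq_abs]
    refine (mul_le_of_le_one_right (abs_nonneg _) ((abs_coord_le _ _).trans hx.le)).trans ?_
    refine (abs_zoomTest_le Q hr k x).trans (le_of_eq ?_)
    rw [hN, zoomSize]
    ring
  have heq : ∫ x, diverg θ (zoom x₀ r x) ∂σ = - ∑ k, ∫ x, φ k x * g x k ∂τ -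
      ∑ k, ∑ j, ∫ x, D k j x * (f x k j - P k j) ∂σ - ∑ k, ∑ j, ∫ x, D k j x * f x k j ∂α := by
    simp only [hsplit, Finset.sum_add_distrib, hmain] at hsum
    linarith
  have B1 : |∑ k, ∑ j, ∫ x, D k j x * (f x k j - P k j) ∂σ| ≤
      q * ∑ k, ∑ j, ∫ x, N x * |f x k j - P k j| ∂σ := by
    simp only [Finset.mul_sum]
    exact (Finset.abs_sum_le_sum_abs _ _).trans (Finset.sum_le_sum fun k _ =>
      (Finset.abs_sum_le_sum_abs _ _).trans (Finset.sum_le_sum fun j _ => b1 k j))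
  have B2 : |∑ k, ∑ j, ∫ x, D k j x * f x k j ∂α| ≤ d * (d * (q * ∫ x, N x ∂α)) := by
    refine (Finset.abs_sum_le_sum_abs _ _).trans ((Finset.sum_le_sum fun k _ =>
      (Finset.abs_sum_le_sum_abs _ _).trans (Finset.sum_le_sum fun j _ => b2 k j)).trans ?_)
    simp
  have B3 : |∑ k, ∫ x, φ k x * g x k ∂τ| ≤ d * (q * (r * ∫ x, N x ∂τ)) := by
    refine (Finset.abs_sum_le_sum_abs _ _).trans ((Finset.sum_le_sum fun k _ => b3 k).trans ?_)
    simp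
  rw [integral_errorMeasure hr hfσ hNc hN0 hK, heq]
  have I1 : 0 ≤ ∑ k, ∑ j, ∫ x, N x * |f x k j - P k j| ∂σ :=
    Finset.sum_nonneg fun k _ => Finset.sum_nonneg fun j _ =>
      integral_nonneg fun x => mul_nonneg (hN0 x) (abs_nonneg _)
  have I2 : 0 ≤ ∫ x, N x ∂α := integral_nonneg hN0
  have I3 : 0 ≤ r * ∫ x, N x ∂τ := mul_nonneg hr.le (integral_nonneg hN0)
  set s1 := ∑ k, ∑ j, ∫ x, N x * |f x k j - P k j| ∂σ
  set s2 := ∫ x, N x ∂α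
  set s3 := r * ∫ x, N x ∂τ
  have hd0 : (0 : ℝ) ≤ d := Nat.cast_nonneg d
  calc _ ≤ d * (q * s3) + q * s1 + d * (d * (q * s2)) := by
        refine (abs_sub _ _).trans (add_le_add ((abs_sub _ _).trans (add_le_add ?_ B1)) B2)
        rw [abs_neg]; exact B3
    _ ≤ q * (d + 1) ^ 2 * (s2 + s1 + s3) := by
        have m1 := mul_nonneg hq0 I1
        have m2 := mul_nonneg hq0 I2
        have m3 := mul_nonneg hq0 I3
        nlinarith [mul_nonneg hd0 m1, mul_nonneg hd0 m2, mul_nonneg hd0 m3,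
          mul_nonneg hd0 (mul_nonneg hd0 m1), mul_nonneg hd0 (mul_nonneg hd0 m3)]

end estimate

section blowup
open Filter Topology
variable {d : ℕ}

lemma ae_frequently_doubling (σ : Measure (Euc d)) [IsFiniteMeasure σ]
    (hσ : σ.MutuallySingular volume) : ∀ᵐ x ∂σ, ∃ᶠ r in 𝓝[>] (0 : ℝ),
      0 < σ.real (closedBall x (r / 4)) ∧
      σ.real (closedBall x r) ≤ 2 * 4 ^ d * σ.real (closedBall x (r / 4)) := by
  have h0 := (Besicovitch.vitaliFamily σ).ae_eventually_measure_zero_of_singular hσ.symm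
  filter_upwards [h0] with x hx
  have hx := hx.comp (Besicovitch.tendsto_filterAt σ x)
  have h1 : ∀ᶠ r in 𝓝[>] (0 : ℝ),
      volume.real (closedBall x r) ≤ σ.real (closedBall x r) := by
    filter_upwards [hx.eventually_lt_const one_pos, self_mem_nhdsWithin] with r hr hr0
    refine ENNReal.toReal_mono (measure_ne_top σ _) ?_
    by_contra hlt
    refine absurd hr (not_lt.2 ?_)
    rw [Function.comp_apply, ENNReal.le_div_iff_mul_le
      (Or.inr (measure_closedBall_pos volume x hr0).ne')
      (Or.inr (measure_closedBall_lt_top (μ := volume)).ne), one_mul]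
    exact (not_le.1 hlt).le
  by_contra hcon
  rw [not_frequently] at hcon
  obtain ⟨r, hr0, hr⟩ := (mem_nhdsGT_iff_exists_Ioc_subset).1 (h1.and hcon)
  have hr0 : 0 < r := hr0
  set w := volume.real (ball (0 : Euc d) 1)
  have hw : 0 < w := ENNReal.toReal_pos (measure_ball_pos _ _ one_pos).ne' measure_ball_lt_top.ne
  have hmem : ∀ n : ℕ, r / 4 ^ n ∈ Set.Ioc 0 r := fun n =>
    ⟨by positivity, div_le_self hr0.le (one_le_pow₀ (by norm_num))⟩
  have hvol : ∀ n : ℕ, (r / 4 ^ n) ^ d * w ≤ σ.real (closedBall x (r / 4 ^ n)) := fun n => by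
    have h := (hr (hmem n)).1
    rwa [Measure.addHaar_real_closedBall volume x (hmem n).1.le, finrank_euclideanSpace_fin] at h
  have hsig : ∀ n : ℕ, σ.real (closedBall x (r / 4 ^ n)) * (2 * 4 ^ d) ^ n ≤
      σ.real (closedBall x r) := by
    intro n
    induction n with
    | zero => simp
    | succ n ih =>
      have h := (hr (hmem n)).2
      have e : r / 4 ^ n / 4 = r / 4 ^ (n + 1) := by rw [pow_succ, div_div]
      rw [e] at h
      have hp : 0 < σ.real (closedBall x (r / 4 ^ (n + 1))) :=
        lt_of_lt_of_le (by positivity) (hvol (n + 1))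
      have h2 := not_le.1 fun hle => h ⟨hp, hle⟩
      refine le_trans ?_ ih
      rw [pow_succ' (2 * 4 ^ d : ℝ), ← mul_assoc, mul_comm _ ((2 * 4 ^ d : ℝ))]
      exact mul_le_mul_of_nonneg_right h2.le (by positivity)
  have hgrow : ∀ n : ℕ, 2 ^ n * (r ^ d * w) ≤ σ.real (closedBall x r) := fun n => by
    refine le_trans (le_of_eq ?_)
      ((mul_le_mul_of_nonneg_right (hvol n) (by positivity)).trans (hsig n))
    rw [mul_pow, div_pow, ← pow_mul, ← pow_mul, mul_comm d n]
    field_simp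
  have ht : Tendsto (fun n : ℕ => (2 : ℝ) ^ n * (r ^ d * w)) atTop atTop :=
    (tendsto_pow_atTop_atTop_of_one_lt one_lt_two).atTop_mul_const (by positivity)
  obtain ⟨n, hn⟩ := (ht.eventually_gt_atTop (σ.real (closedBall x r))).exists
  exact absurd (hgrow n) (not_le.2 hn)

lemma ae_tendsto_errorMeasure_div {σ α τ : Measure (Euc d)} [IsFiniteMeasure σ] [IsFiniteMeasure α]
    [IsFiniteMeasure τ] (hα : α.MutuallySingular σ) {f : Euc d → Fin d → Fin d → ℝ}
    (hf : ∀ k j, Integrable (fun x => f x k j) σ) : ∀ᵐ x ∂σ,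
      Tendsto (fun r => errorMeasure σ α τ f (f x) r (closedBall x r) / σ (closedBall x r))
        (𝓝[>] 0) (𝓝 0) := by
  have h1 := (Besicovitch.vitaliFamily σ).ae_eventually_measure_zero_of_singular hα
  have h2 : ∀ᵐ x ∂σ, ∀ k j, Tendsto (fun a => (∫⁻ y in a, ‖f y k j - f x k j‖ₑ ∂σ) / σ a)
      ((Besicovitch.vitaliFamily σ).filterAt x) (𝓝 0) := by
    rw [ae_all_iff]; intro k
    rw [ae_all_iff]; intro j
    exact (Besicovitch.vitaliFamily σ).ae_tendsto_lintegral_enorm_sub_div_of_integrable (hf k j)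
  have h3 := Besicovitch.ae_tendsto_rnDeriv τ σ
  filter_upwards [h1, h2, h3, τ.rnDeriv_lt_top σ] with x x1 x2 x3 x4
  have hB := Besicovitch.tendsto_filterAt σ x
  have e : ∀ r : ℝ, errorMeasure σ α τ f (f x) r (closedBall x r) / σ (closedBall x r) =
      α (closedBall x r) / σ (closedBall x r) +
      ∑ k, ∑ j, (∫⁻ y in closedBall x r, ‖f y k j - f x k j‖ₑ ∂σ) / σ (closedBall x r) +
      ENNReal.ofReal r * (τ (closedBall x r) / σ (closedBall x r)) := by
    intro r
    have m : ∀ k j, AEMeasurable (fun y => ‖f y k j - f x k j‖ₑ) (σ.restrict (closedBall x r)) :=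
      fun k j => (((hf k j).1.sub aestronglyMeasurable_const).enorm).restrict
    rw [errorMeasure, Measure.add_apply, Measure.add_apply, Measure.smul_apply, smul_eq_mul,
      ENNReal.add_div, ENNReal.add_div, mul_div_assoc,
      withDensity_apply _ measurableSet_closedBall]
    congr 2
    unfold entryDist
    rw [lintegral_finsetSum' _ fun k _ => Finset.aemeasurable_fun_sum _ fun j _ => m k j]
    simp only [div_eq_mul_inv, Finset.sum_mul]
    refine Finset.sum_congr rfl fun k _ => ?_
    rw [lintegral_finsetSum' _ fun j _ => m k j, Finset.sum_mul]
  simp only [e]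
  have t1 := x1.comp hB
  have t2 := tendsto_finsetSum (Finset.univ : Finset (Fin d)) fun k _ =>
    tendsto_finsetSum (Finset.univ : Finset (Fin d)) fun j _ => (x2 k j).comp hB
  have t0 : Tendsto (fun r : ℝ => ENNReal.ofReal r) (𝓝[>] 0) (𝓝 0) := by
    have := (ENNReal.continuous_ofReal.tendsto 0).mono_left (nhdsWithin_le_nhds (s := Set.Ioi 0))
    rwa [ENNReal.ofReal_zero] at this
  have t3 := ENNReal.Tendsto.mul t0 (Or.inr x4.ne) x3 (Or.inr ENNReal.zero_ne_top)
  have t := (t1.add t2).add t3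
  simpa using t

lemma mutuallySingular_map_zoom {σ : Measure (Euc d)} (hσ : σ.MutuallySingular volume)
    (x₀ : Euc d) {r : ℝ} (hr : 0 < r) : (σ.map (zoom x₀ r)).MutuallySingular volume := by
  obtain ⟨s, hs, h1, h2⟩ := hσ
  have hT : Continuous fun y : Euc d => r • y + x₀ := by fun_prop
  refine ⟨(fun y => r • y + x₀) ⁻¹' s, hT.measurable hs, ?_, ?_⟩
  · rw [Measure.map_apply (continuous_zoom x₀ r).measurable (hT.measurable hs)]
    convert h1 using 2
    ext x
    simp [zoom, smul_smul, hr.ne']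
  · have e : ((fun y : Euc d => r • y + x₀) ⁻¹' s)ᶜ =
        (fun y => r • y) ⁻¹' ((fun y => y + x₀) ⁻¹' sᶜ) := rfl
    rw [e, Measure.addHaar_preimage_smul _ hr.ne', measure_preimage_add_right, h2, mul_zero]

/-- A measure of the form `P σ` with `P` invertible and `σ` singular cannot be a blow-up limit. -/
theorem not_tendsto_errorMeasure_div (hd : 0 < d) {σ α τ : Measure (Euc d)} [IsFiniteMeasure σ]
    [IsFiniteMeasure α] [IsFiniteMeasure τ] (hσ : σ.MutuallySingular volume)
    {f : Euc d → Fin d → Fin d → ℝ} {g : Euc d → Euc d} {P Q : Fin d → Fin d → ℝ}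
    (hQ : ∀ i j, ∑ k, Q i k * P k j = if i = j then 1 else 0)
    (hfm : ∀ k j, AEStronglyMeasurable (fun x => f x k j) (σ + α))
    (hf1 : ∀ᵐ x ∂(σ + α), ∀ k j, |f x k j| ≤ 1)
    (hg1 : ∀ᵐ x ∂τ, ‖g x‖ = 1) {Ω : Set (Euc d)} (hΩ : IsOpen Ω)
    (hdiv : ∀ φ : Euc d → ℝ, ContDiff ℝ (⊤ : ℕ∞) φ → HasCompactSupport φ →
      tsupport φ ⊆ Ω → ∀ k : Fin d,
        ∑ j, ∫ x, pderiv' j φ x * f x k j ∂(σ + α) = - ∫ x, φ x * g x k ∂τ)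
    {x₀ : Euc d} (hx₀ : x₀ ∈ Ω)
    (hdoub : ∃ᶠ r in 𝓝[>] (0 : ℝ), 0 < σ.real (closedBall x₀ (r / 4)) ∧
      σ.real (closedBall x₀ r) ≤ 2 * 4 ^ d * σ.real (closedBall x₀ (r / 4))) :
    ¬ Tendsto (fun r => errorMeasure σ α τ f P r (closedBall x₀ r) / σ (closedBall x₀ r))
        (𝓝[>] 0) (𝓝 0) := by
  intro hlim
  set C₀ : ℝ := 2 * 4 ^ d with hC₀
  have hC₀p : 0 < C₀ := by positivity
  obtain ⟨ε, hε, hcore⟩ := exists_testField hd hC₀p.le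
  set C₁ : ℝ := absSum Q * (d + 1) ^ 2 with hC₁
  have hC₁p : 0 ≤ C₁ := mul_nonneg (absSum_nonneg Q) (by positivity)
  set δ : ℝ := ε / ((C₁ + 1) * C₀) with hδ
  have hδ0 : 0 < δ := by positivity
  have hball : ∀ᶠ r in 𝓝[>] (0 : ℝ), closedBall x₀ r ⊆ Ω := by
    obtain ⟨R, hR, hRΩ⟩ := Metric.isOpen_iff.1 hΩ x₀ hx₀
    filter_upwards [nhdsWithin_le_nhds (Iio_mem_nhds hR)] with r hr
    exact (closedBall_subset_ball hr).trans hRΩ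
  have hpos : ∀ᶠ r in 𝓝[>] (0 : ℝ), 0 < r := self_mem_nhdsWithin
  obtain ⟨r, ⟨hm0, hm1⟩, hr, hrΩ, hrδ⟩ := (hdoub.and_eventually (hpos.and (hball.and
    (hlim.eventually_lt_const (ENNReal.ofReal_pos.2 hδ0))))).exists
  set m := σ.real (closedBall x₀ (r / 4)) with hm
  have hfσ : ∀ k j, Integrable (fun x => f x k j) σ := fun k j =>
    (Integrable.mono' (integrable_const 1) (hfm k j)
      (hf1.mono fun x hx => hx k j)).left_of_add_measure
  have hfin : IsFiniteMeasure (errorMeasure σ α τ f P r) := isFiniteMeasure_errorMeasure hfσ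
  set lam := errorMeasure σ α τ f P r with hlam
  have hlamr : lam.real (closedBall x₀ r) ≤ δ * (C₀ * m) := by
    have h1 : 0 < σ.real (closedBall x₀ r) := hm0.trans_le
      (measureReal_mono (closedBall_subset_closedBall (by linarith)) (measure_ne_top σ _))
    have h2 : σ (closedBall x₀ r) ≠ 0 := fun h => by simp [measureReal_def, h] at h1
    have h3 := ENNReal.toReal_mono ENNReal.ofReal_ne_top hrδ.le
    rw [ENNReal.toReal_div, ENNReal.toReal_ofReal hδ0.le] at h3
    have h4 := (div_le_iff₀ h1).1 h3
    exact h4.trans (mul_le_mul_of_nonneg_left hm1 hδ0.le)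
  set σ' := ENNReal.ofReal m⁻¹ • (σ.restrict (closedBall x₀ r)).map (zoom x₀ r) with hσ'
  set τ' := ENNReal.ofReal (m⁻¹ * C₁) • (lam.restrict (closedBall x₀ r)).map (zoom x₀ r) with hτ'
  have hzm := (continuous_zoom x₀ r).measurable
  have f1 : IsFiniteMeasure σ' := Measure.smul_finite _ ENNReal.ofReal_ne_top
  have f2 : IsFiniteMeasure τ' := Measure.smul_finite _ ENNReal.ofReal_ne_top
  have hsing : σ'.MutuallySingular volume :=
    (mutuallySingular_map_zoom (hσ.mono_ac Measure.restrict_le_self.absolutelyContinuous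
      Measure.AbsolutelyContinuous.rfl) x₀ hr).smul _
  have u1 : σ'.real Set.univ ≤ C₀ := by
    rw [hσ', measureReal_ennreal_smul_apply, ENNReal.toReal_ofReal (by positivity),
      measureReal_def, Measure.map_apply hzm MeasurableSet.univ, Set.preimage_univ,
      Measure.restrict_apply_univ, ← measureReal_def, inv_mul_le_iff₀ hm0, mul_comm m]
    exact hm1
  have u2 : 1 ≤ σ'.real (closedBall 0 (1 / 4)) := by
    have e : zoom x₀ r ⁻¹' closedBall 0 (1 / 4) = closedBall x₀ (r / 4) := by
      ext x
      rw [Set.mem_preimage, mem_closedBall_zero_iff, zoom, norm_smul, norm_inv,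
        Real.norm_of_nonneg hr.le, inv_mul_le_iff₀ hr, mem_closedBall, dist_eq_norm]
      ring_nf
    rw [hσ', measureReal_ennreal_smul_apply, ENNReal.toReal_ofReal (by positivity),
      measureReal_def, Measure.map_apply hzm measurableSet_closedBall, e,
      Measure.restrict_apply measurableSet_closedBall,
      Set.inter_eq_left.2 (closedBall_subset_closedBall (by linarith)), ← measureReal_def,
      inv_mul_cancel₀ hm0.ne']
  have u3 : τ'.real Set.univ ≤ ε := by
    rw [hτ', measureReal_ennreal_smul_apply, ENNReal.toReal_ofReal (by positivity),
      measureReal_def, Measure.map_apply hzm MeasurableSet.univ, Set.preimage_univ,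
      Measure.restrict_apply_univ, ← measureReal_def]
    calc m⁻¹ * C₁ * lam.real (closedBall x₀ r) ≤ m⁻¹ * (C₁ + 1) * (δ * (C₀ * m)) := by
          gcongr
          linarith
      _ = ε := by rw [hδ]; field_simp
  obtain ⟨θ, hθ, hs, hlt⟩ := hcore σ' τ' hsing u1 u2 u3
  have hmain := abs_integral_diverg_zoom_le hr hQ hθ hs hfm hf1 hg1
    fun φ h1 h2 h3 => hdiv φ h1 h2 (h3.trans hrΩ)
  have hDθ : Continuous (fderiv ℝ θ) := hθ.continuous_fderiv (by simp)
  have hdc : Continuous (diverg θ) := by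
    unfold diverg
    refine continuous_finsetSum _ fun i _ => ?_
    exact (continuous_apply i).comp ((PiLp.continuous_ofLp 2 _).comp
      (hDθ.clm_apply continuous_const))
  have hz : ∀ x, x ∉ closedBall x₀ r → zoom x₀ r x ∉ tsupport θ := fun x hx h =>
    zoom_notMem_ball hr hx (hs h)
  have hθ0 : ∀ x, x ∉ closedBall x₀ r → θ (zoom x₀ r x) = 0 := fun x hx =>
    image_eq_zero_of_notMem_tsupport (hz x hx)
  have hD0 : ∀ x, x ∉ closedBall x₀ r → fderiv ℝ θ (zoom x₀ r x) = 0 := fun x hx =>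
    image_eq_zero_of_notMem_tsupport fun h => hz x hx (tsupport_fderiv_subset ℝ h)
  have e1 : ∫ x, diverg θ x ∂σ' = m⁻¹ * ∫ x, diverg θ (zoom x₀ r x) ∂σ := by
    rw [hσ', integral_smul_measure, ENNReal.toReal_ofReal (by positivity), smul_eq_mul,
      integral_map hzm.aemeasurable hdc.aestronglyMeasurable,
      setIntegral_eq_integral_of_forall_compl_eq_zero]
    intro x hx
    simp [diverg, hD0 x hx]
  have hNc : Continuous fun x => ‖fderiv ℝ θ x‖ + ‖θ x‖ := hDθ.norm.add hθ.continuous.norm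
  have e2 : ∫ x, (‖fderiv ℝ θ x‖ + ‖θ x‖) ∂τ' = m⁻¹ * C₁ * ∫ x, zoomSize x₀ r θ x ∂lam := by
    rw [hτ', integral_smul_measure, ENNReal.toReal_ofReal (by positivity), smul_eq_mul,
      integral_map hzm.aemeasurable hNc.aestronglyMeasurable,
      setIntegral_eq_integral_of_forall_compl_eq_zero]
    · rfl
    intro x hx
    simp [hθ0 x hx, hD0 x hx]
  rw [e1, e2, abs_mul, abs_of_pos (inv_pos.2 hm0), mul_assoc] at hlt
  exact absurd hmain (not_le.2 (lt_of_mul_lt_mul_left hlt (inv_pos.2 hm0).le))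

end blowup

end DivMeasure

/-- **Rank bound for matrix-valued measures with measure divergence.**
Let `μ = f·ρ` be a finite `ℝ^{d×d}`-valued Radon measure on the open set `Ω`
(`ρ = |μ|` finite positive concentrated on `Ω`, `f` the polar with Frobenius norm one
`ρ`-a.e.), and suppose the row-wise distributional divergence `Div μ` is represented by
a finite `ℝ^d`-valued Radon measure `σ = g·τ` on `Ω`.  Then the polar has rank at most
`d − 1` at `|μ|^s`-a.e. point. -/
theorem statement6 {d : ℕ}
    (Ω : Set (EuclideanSpace ℝ (Fin d))) (hΩ : IsOpen Ω)
    (ρ : Measure (EuclideanSpace ℝ (Fin d))) [IsFiniteMeasure ρ]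
    (hρΩ : ρ Ωᶜ = 0)
    (f : EuclideanSpace ℝ (Fin d) → Matrix (Fin d) (Fin d) ℝ)
    (hf : AEStronglyMeasurable f ρ)
    (hpolar : ∀ᵐ x ∂ρ, ∑ k, ∑ j, (f x k j) ^ 2 = 1)
    (τ : Measure (EuclideanSpace ℝ (Fin d))) [IsFiniteMeasure τ]
    (hτΩ : τ Ωᶜ = 0)
    (g : EuclideanSpace ℝ (Fin d) → EuclideanSpace ℝ (Fin d))
    (hg : AEStronglyMeasurable g τ)
    (hgpolar : ∀ᵐ x ∂τ, ‖g x‖ = 1)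
    (hDiv : ∀ φ : EuclideanSpace ℝ (Fin d) → ℝ,
      ContDiff ℝ (⊤ : ℕ∞) φ → HasCompactSupport φ → tsupport φ ⊆ Ω →
      ∀ k : Fin d,
        ∑ j, ∫ x, pderiv' j φ x * f x k j ∂ρ = - ∫ x, φ x * g x k ∂τ) :
    ∀ᵐ x ∂(ρ.singularPart volume), (f x).rank ≤ d - 1 := by
  rcases Nat.eq_zero_or_pos d with hd | hd
  · refine Filter.Eventually.of_forall fun x => (Matrix.rank_le_card_width (f x)).trans ?_
    simp [hd]
  set σ := ρ.singularPart volume with hσdef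
  set α := volume.withDensity (ρ.rnDeriv volume) with hαdef
  have hσ : σ.MutuallySingular volume := Measure.mutuallySingular_singularPart ρ volume
  have hρ : ρ = σ + α := Measure.haveLebesgueDecomposition_add ρ volume
  have hσρ : σ ≤ ρ := Measure.singularPart_le ρ volume
  have hαρ : α ≤ ρ := Measure.withDensity_rnDeriv_le ρ volume
  have hαfin : IsFiniteMeasure α := isFiniteMeasure_of_le ρ hαρ
  have hασ : α.MutuallySingular σ :=
    (hσ.mono_ac Measure.AbsolutelyContinuous.rfl (withDensity_absolutelyContinuous _ _)).symm
  have hfm : ∀ k j, AEStronglyMeasurable (fun x => f x k j) ρ := fun k j =>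
    ((continuous_id.matrix_elem k j).comp_aestronglyMeasurable hf :)
  have hf1 : ∀ᵐ x ∂ρ, ∀ k j, |f x k j| ≤ 1 := by
    filter_upwards [hpolar] with x hx k j
    rw [← sq_le_one_iff_abs_le_one, ← hx]
    exact (Finset.single_le_sum (f := fun j => f x k j ^ 2) (fun _ _ => sq_nonneg _)
      (Finset.mem_univ j)).trans (Finset.single_le_sum (f := fun k => ∑ j, f x k j ^ 2)
        (fun _ _ => Finset.sum_nonneg fun _ _ => sq_nonneg _) (Finset.mem_univ k))
  have hfσ : ∀ k j, Integrable (fun x => f x k j) σ := fun k j =>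
    (Integrable.mono' (integrable_const 1) (hfm k j)
      (hf1.mono fun x hx => hx k j)).mono_measure hσρ
  have hΩσ : ∀ᵐ x ∂σ, x ∈ Ω := ae_mono hσρ (measure_eq_zero_iff_ae_notMem.1 hρΩ |>.mono
    fun x hx => by simpa using hx)
  filter_upwards [hΩσ, DivMeasure.ae_frequently_doubling σ hσ,
    DivMeasure.ae_tendsto_errorMeasure_div (τ := τ) hασ hfσ] with x hxΩ hdoub hlim
  by_contra hrank
  have hrk : (f x).rank = d := le_antisymm
    (by simpa using Matrix.rank_le_card_width (f x)) (by omega)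
  have hunit : IsUnit (f x) := by
    rw [← Matrix.mulVec_surjective_iff_isUnit, ← Matrix.coe_mulVecLin, ← LinearMap.range_eq_top]
    apply Submodule.eq_top_of_finrank_eq
    rw [← Matrix.rank, hrk]
    simp
  have hinv := Matrix.nonsing_inv_mul (f x) ((Matrix.isUnit_iff_isUnit_det _).1 hunit)
  refine DivMeasure.not_tendsto_errorMeasure_div hd hσ (Q := fun i k => (f x)⁻¹ i k) (g := g) (Ω := Ω)
    (fun i j => ?_) (hρ ▸ hfm) (hρ ▸ hf1) hgpolar hΩ (fun φ h1 h2 h3 k => ?_) hxΩ hdoub hlim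
  · rw [← Matrix.one_apply, ← hinv, Matrix.mul_apply]
  · rw [← hρ]
    exact hDiv φ h1 h2 h3 k
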